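/- arXiv:1302.7040 — 4 statements merged into one kernel-verified Lean document; each statement's English description precedes it below -/
import Mathlib

section
/- Let H and K be complex Hilbert spaces and let Φ : B(H) → B(K) be a unital positive linear map. Let p, q be nonzero real numbers satisfying condition (★). Then for every positive invertible operator A ∈ B(H), one has Φ(A^p)^{1/p} ≤ Φ(A^q)^{1/q}. -/
/-- Condition (★) on a pair `(p, q)` of real parameters. -/
def StarCond (p q : ℝ) : Prop :=
  p = q ∨ (1 ≤ p ∧ p < q) ∨ (p < q ∧ q ≤ -1) ∨ (p ≤ -1 ∧ 1 ≤ q) ∨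
    (1/2 ≤ p ∧ p < 1 ∧ 1 ≤ q) ∨ (p ≤ -1 ∧ -1 < q ∧ q ≤ -1/2)

open scoped InnerProductSpace NNReal Polynomial

namespace PM
section key
variable {𝔄 K : Type*} [CStarAlgebra 𝔄] [PartialOrder 𝔄] [StarOrderedRing 𝔄]
  [NormedAddCommGroup K] [InnerProductSpace ℂ K] [CompleteSpace K]

lemma quad_nonneg (T : K →L[ℂ] K) (hT : 0 ≤ T) (x y : K) (c : ℝ) :
    0 ≤ (⟪T x, x⟫_ℂ).re + c * (2 * (⟪T x, y⟫_ℂ).re) + c ^ 2 * (⟪T y, y⟫_ℂ).re := by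
  have hT' := (ContinuousLinearMap.nonneg_iff_isPositive T).1 hT
  have h := hT'.re_inner_nonneg_left (x + (c : ℂ) • y)
  have h2 : (⟪T y, x⟫_ℂ).re = (⟪T x, y⟫_ℂ).re := by
    rw [hT'.inner_left_eq_inner_right, ← inner_conj_symm, Complex.conj_re]
  simp only [map_add, map_smul, inner_add_left, inner_add_right, inner_smul_left,
    inner_smul_right, RCLike.re_to_complex] at h
  simp [h2] at h
  nlinarith [h]

lemma bern_sq (n : ℕ) : (∑ k ∈ Finset.range (n + 1), (k ^ 2) • bernsteinPolynomial ℝ n k)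
    = (n * (n - 1)) • Polynomial.X ^ 2 + n • Polynomial.X := by
  rw [← bernsteinPolynomial.sum_mul_smul, ← bernsteinPolynomial.sum_smul, ← Finset.sum_add_distrib]
  refine Finset.sum_congr rfl fun k _ => ?_
  rw [← add_smul]
  congr 1
  cases k <;> simp; ring

lemma bern_nonneg (X : 𝔄) (h0 : 0 ≤ X) (h1 : X ≤ 1) (n k : ℕ) :
    0 ≤ Polynomial.aeval X (bernsteinPolynomial ℝ n k) := by
  simp only [bernsteinPolynomial, map_mul, map_natCast, map_pow, Polynomial.aeval_X, map_sub, map_one]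
  have h1' : 0 ≤ 1 - X := sub_nonneg.2 h1
  have c : Commute X (1 - X) := (Commute.one_right X).sub_right (Commute.refl X)
  have a1 : (0:𝔄) ≤ X ^ k := CStarAlgebra.pow_nonneg h0 k
  have a2 : (0:𝔄) ≤ (1 - X) ^ (n-k) := CStarAlgebra.pow_nonneg h1' _
  rw [mul_assoc, ← nsmul_eq_mul]
  exact nsmul_nonneg (Commute.mul_nonneg a1 a2 (c.pow_pow _ _)) _

lemma key01 (Φ : 𝔄 →ₗ[ℂ] (K →L[ℂ] K)) (hΦ : ∀ T, 0 ≤ T → 0 ≤ Φ T)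
    (X : 𝔄) (h0 : 0 ≤ X) (h1 : X ≤ 1) (x y : K) :
    0 ≤ (⟪Φ 1 x, x⟫_ℂ).re + 2 * (⟪Φ X x, y⟫_ℂ).re + (⟪Φ (X ^ 2) y, y⟫_ℂ).re := by
  let F (u v : K) : ℝ[X] →+ ℝ :=
    { toFun := fun P => (⟪Φ (Polynomial.aeval X P) u, v⟫_ℂ).re
      map_zero' := by simp
      map_add' := by intro P Q; simp }
  have hF : ∀ u v P, F u v P = (⟪Φ (Polynomial.aeval X P) u, v⟫_ℂ).re := fun _ _ _ => rfl
  have main : ∀ n : ℕ, 0 < n → 0 ≤ (⟪Φ 1 x, x⟫_ℂ).re + 2 * (⟪Φ X x, y⟫_ℂ).re +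
      (⟪Φ (X ^ 2) y, y⟫_ℂ).re +
        ((⟪Φ X y, y⟫_ℂ).re - (⟪Φ (X ^ 2) y, y⟫_ℂ).re) / (n : ℝ) := by
    intro n hn
    have hn' : (0 : ℝ) < n := by exact_mod_cast hn
    have e0 := congrArg (F x x) (bernsteinPolynomial.sum ℝ n)
    have e1 := congrArg (F x y) (bernsteinPolynomial.sum_smul ℝ n)
    have e2 := congrArg (F y y) (bern_sq n)
    have s : 0 ≤ ∑ k ∈ Finset.range (n + 1), (F x x (bernsteinPolynomial ℝ n k) +
        ((k:ℝ) / n) * (2 * F x y (bernsteinPolynomial ℝ n k)) +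
        ((k:ℝ) / n) ^ 2 * F y y (bernsteinPolynomial ℝ n k)) :=
      Finset.sum_nonneg fun k _ => quad_nonneg _ (hΦ _ (bern_nonneg X h0 h1 n k)) x y _
    simp only [map_sum, map_nsmul, map_add] at e0 e1 e2
    simp only [nsmul_eq_mul] at e1 e2
    rw [Finset.sum_add_distrib, Finset.sum_add_distrib, e0] at s
    have e1' : ∑ k ∈ Finset.range (n + 1), ((k:ℝ) / n) * (2 * F x y (bernsteinPolynomial ℝ n k))
        = 2 * F x y Polynomial.X := by
      have : ∀ k : ℕ, ((k:ℝ) / n) * (2 * F x y (bernsteinPolynomial ℝ n k)) =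
        (2 / n) * (k * F x y (bernsteinPolynomial ℝ n k)) := by intro k; ring
      simp_rw [this]
      rw [← Finset.mul_sum, e1]; field_simp
    have e2' : ∑ k ∈ Finset.range (n + 1), ((k:ℝ) / n) ^ 2 * F y y (bernsteinPolynomial ℝ n k)
        = F y y (Polynomial.X ^ 2) + (F y y Polynomial.X - F y y (Polynomial.X ^ 2)) / n := by
      have : ∀ k : ℕ, ((k:ℝ) / n) ^ 2 * F y y (bernsteinPolynomial ℝ n k) =
        (1 / n ^ 2) * (((k ^ 2 : ℕ):ℝ) * F y y (bernsteinPolynomial ℝ n k)) := by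
        intro k; push_cast; ring
      simp_rw [this]
      rw [← Finset.mul_sum, e2, Nat.cast_mul, Nat.cast_sub (by omega)]; field_simp; push_cast; ring
    rw [e1', e2'] at s
    simp only [hF, map_pow, Polynomial.aeval_X, map_one] at s
    linarith
  have lim : Filter.Tendsto (fun n : ℕ => (⟪Φ 1 x, x⟫_ℂ).re + 2 * (⟪Φ X x, y⟫_ℂ).re +
      (⟪Φ (X ^ 2) y, y⟫_ℂ).re +
        ((⟪Φ X y, y⟫_ℂ).re - (⟪Φ (X ^ 2) y, y⟫_ℂ).re) / (n : ℝ)) Filter.atTop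
      (nhds ((⟪Φ 1 x, x⟫_ℂ).re + 2 * (⟪Φ X x, y⟫_ℂ).re +
      (⟪Φ (X ^ 2) y, y⟫_ℂ).re + 0)) :=
    tendsto_const_nhds.add (tendsto_const_div_atTop_nhds_zero_nat _)
  rw [add_zero] at lim
  exact ge_of_tendsto lim (Filter.eventually_atTop.2 ⟨1, fun n hn => main n hn⟩)

lemma key (Φ : 𝔄 →ₗ[ℂ] (K →L[ℂ] K)) (hΦ : ∀ T, 0 ≤ T → 0 ≤ Φ T)
    (X : 𝔄) (h0 : 0 ≤ X) (x y : K) :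
    0 ≤ (⟪Φ 1 x, x⟫_ℂ).re + 2 * (⟪Φ X x, y⟫_ℂ).re + (⟪Φ (X ^ 2) y, y⟫_ℂ).re := by
  obtain ⟨c, hc, hcX⟩ : ∃ c : ℝ, 0 < c ∧ ‖X‖ ≤ c := ⟨‖X‖ + 1, by positivity, by linarith⟩
  have hci : (0:ℝ) ≤ c⁻¹ := by positivity
  have g0 : 0 ≤ c⁻¹ • X := smul_nonneg hci h0
  have g1 : c⁻¹ • X ≤ 1 := by
    rw [← CStarAlgebra.norm_le_one_iff_of_nonneg _ g0, norm_smul, Real.norm_of_nonneg hci]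
    rw [inv_mul_le_iff₀ hc]; simpa
  have h := key01 Φ hΦ (c⁻¹ • X) g0 g1 x ((c:ℂ) • y)
  have e : c⁻¹ • X = ((c:ℂ)⁻¹) • X := by
    rw [← Complex.ofReal_inv]; exact (Complex.coe_smul _ _).symm
  have hc' : (c:ℂ) ≠ 0 := by exact_mod_cast hc.ne'
  rw [e, smul_pow] at h
  simp only [map_smul, smul_apply, inner_smul_left, inner_smul_right] at h
  have t1 : ∀ z : ℂ, (c:ℂ) * ((starRingEnd ℂ) (c:ℂ)⁻¹ * z) = z := by
    intro z; simp; field_simp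
  have t2 : ∀ z : ℂ, (c:ℂ) * ((starRingEnd ℂ) (c:ℂ) * ((starRingEnd ℂ) ((c:ℂ)⁻¹ ^ 2) * z)) = z := by
    intro z; simp; field_simp
  have t3 : ∀ z : ℂ, (c:ℂ) * ((starRingEnd ℂ) ((c:ℂ)⁻¹ ^ 2) * ((starRingEnd ℂ) (c:ℂ) * z)) = z := by
    intro z; simp; field_simp
  have t4 : ∀ z : ℂ, (starRingEnd ℂ) ((c:ℂ)⁻¹ ^ 2) * ((c:ℂ) * ((starRingEnd ℂ) (c:ℂ) * z)) = z := by
    intro z; simp; field_simp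
  simpa only [t1, t2, t3, t4] using h
end key

section jensen
variable {𝔄 K : Type*} [CStarAlgebra 𝔄] [PartialOrder 𝔄] [StarOrderedRing 𝔄]
  [NormedAddCommGroup K] [InnerProductSpace ℂ K] [CompleteSpace K]

lemma le_of_re (S T : K →L[ℂ] K) (hS : IsSelfAdjoint S) (hT : IsSelfAdjoint T)
    (h : ∀ z, (⟪S z, z⟫_ℂ).re ≤ (⟪T z, z⟫_ℂ).re) : S ≤ T := by
  rw [ContinuousLinearMap.le_def, ContinuousLinearMap.isPositive_def']
  refine ⟨hT.sub hS, fun z => ?_⟩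
  have := h z
  simp only [ContinuousLinearMap.reApplyInnerSelf_apply, sub_apply, inner_sub_left, map_sub,
    RCLike.re_to_complex]
  linarith

lemma map_strict (Φ : 𝔄 →ₗ[ℂ] (K →L[ℂ] K)) (hΦ : ∀ T, 0 ≤ T → 0 ≤ Φ T) (hΦ1 : Φ 1 = 1)
    (X : 𝔄) (hX : IsStrictlyPositive X) : IsStrictlyPositive (Φ X) := by
  rcases subsingleton_or_nontrivial 𝔄 with h | h
  · have : X = 1 := Subsingleton.elim _ _
    rw [this, hΦ1]
    exact ⟨zero_le_one, isUnit_one⟩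
  · obtain ⟨r, hr, hrX⟩ := (CFC.exists_pos_algebraMap_le_iff (a := X) hX.nonneg.isSelfAdjoint).2
      (fun x hx => hX.spectrum_pos hx)
    have h1 : 0 ≤ Φ (X - algebraMap ℝ 𝔄 r) := hΦ _ (sub_nonneg.2 hrX)
    have h2 : Φ (algebraMap ℝ 𝔄 r) = algebraMap ℝ (K →L[ℂ] K) r := by
      rw [Algebra.algebraMap_eq_smul_one, Algebra.algebraMap_eq_smul_one, ← Complex.coe_smul,
        map_smul, hΦ1, Complex.coe_smul]
    rw [map_sub, sub_nonneg, h2] at h1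
    refine IsStrictlyPositive.of_le ?_ h1
    rw [Algebra.algebraMap_eq_smul_one]
    exact ⟨smul_nonneg hr.le zero_le_one, (isUnit_one).smul (Units.mk0 r hr.ne')⟩

lemma jen_inv (Φ : 𝔄 →ₗ[ℂ] (K →L[ℂ] K)) (hΦ : ∀ T, 0 ≤ T → 0 ≤ Φ T) (hΦ1 : Φ 1 = 1)
    (X : 𝔄) (hX : IsStrictlyPositive X) : (Φ X) ^ (-1 : ℝ) ≤ Φ (X ^ (-1 : ℝ)) := by
  have hP := map_strict Φ hΦ hΦ1 X hX
  let S : 𝔄 := X ^ (1 / 2 : ℝ)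
  have hS : 0 ≤ S := CFC.rpow_nonneg
  let Ψ : 𝔄 →ₗ[ℂ] (K →L[ℂ] K) := Φ ∘ₗ LinearMap.mulLeftRight ℂ (S, S)
  have hΨd : ∀ T, Ψ T = Φ (S * T * S) := fun T => rfl
  have hΨ : ∀ T, 0 ≤ T → 0 ≤ Ψ T := fun T hT => hΦ _ (hS.isSelfAdjoint.conjugate_nonneg hT)
  have e0 : Ψ 1 = Φ X := by
    rw [hΨd, mul_one, ← CFC.rpow_add hX.isUnit]
    norm_num [CFC.rpow_one X hX.nonneg]
  have e1 : Ψ (X ^ (-1 : ℝ)) = 1 := by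
    rw [hΨd, ← CFC.rpow_add hX.isUnit, ← CFC.rpow_add hX.isUnit]
    norm_num [CFC.rpow_zero X hX.nonneg, hΦ1]
  have e2 : Ψ ((X ^ (-1 : ℝ)) ^ 2) = Φ (X ^ (-1 : ℝ)) := by
    rw [hΨd, pow_two, ← CFC.rpow_add hX.isUnit, ← CFC.rpow_add hX.isUnit, ← CFC.rpow_add hX.isUnit]
    norm_num
  have hR : (0 : K →L[ℂ] K) ≤ (Φ X) ^ (-1 : ℝ) := CFC.rpow_nonneg
  have hQ : (0 : K →L[ℂ] K) ≤ Φ (X ^ (-1 : ℝ)) := hΦ _ CFC.rpow_nonneg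
  have hmul : Φ X * (Φ X) ^ (-1 : ℝ) = 1 := by
    have := CFC.rpow_mul_rpow_neg (a := Φ X) 1 hP
    rwa [CFC.rpow_one (Φ X) hP.nonneg] at this
  refine le_of_re _ _ hR.isSelfAdjoint hQ.isSelfAdjoint fun z => ?_
  have k := key Ψ hΨ (X ^ (-1 : ℝ)) CFC.rpow_nonneg (-((Φ X) ^ (-1 : ℝ)) z) z
  rw [e0, e1, e2] at k
  have m : Φ X (((Φ X) ^ (-1 : ℝ)) z) = z := by
    have := congrArg (fun T : K →L[ℂ] K => T z) hmul
    simpa using this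
  have m2 : (⟪z, ((Φ X) ^ (-1 : ℝ)) z⟫_ℂ).re = (⟪((Φ X) ^ (-1 : ℝ)) z, z⟫_ℂ).re := by
    rw [← inner_conj_symm, Complex.conj_re]
  simp only [neg_apply, map_neg, m, inner_neg_right, one_apply_eq_self, inner_neg_left, Complex.neg_re, neg_neg, m2] at k
  linarith

lemma kadison (Φ : 𝔄 →ₗ[ℂ] (K →L[ℂ] K)) (hΦ : ∀ T, 0 ≤ T → 0 ≤ Φ T) (hΦ1 : Φ 1 = 1)
    (X : 𝔄) (hX : 0 ≤ X) : (Φ X) ^ 2 ≤ Φ (X ^ 2) := by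
  have hP := hΦ X hX
  refine le_of_re _ _ (hP.isSelfAdjoint.pow 2)
    (hΦ _ (CStarAlgebra.pow_nonneg hX 2)).isSelfAdjoint fun z => ?_
  have k := key Φ hΦ X hX (-(Φ X) z) z
  have m : ⟪Φ X (Φ X z), z⟫_ℂ = ⟪Φ X z, Φ X z⟫_ℂ :=
    ((ContinuousLinearMap.nonneg_iff_isPositive _).1 hP).inner_left_eq_inner_right _ _
  have m2 : ((Φ X) ^ 2) z = Φ X (Φ X z) := by rw [pow_two]; rfl
  rw [hΦ1] at k
  simp only [one_apply_eq_self, neg_apply, inner_neg_right, map_neg, inner_neg_left, Complex.neg_re, neg_neg, m] at k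
  rw [m2, m]
  linarith

lemma real_smul (Φ : 𝔄 →ₗ[ℂ] (K →L[ℂ] K)) (c : ℝ) (X : 𝔄) : Φ (c • X) = c • Φ X := by
  rw [← Complex.coe_smul, map_smul, Complex.coe_smul]

lemma real_alg (Φ : 𝔄 →ₗ[ℂ] (K →L[ℂ] K)) (hΦ1 : Φ 1 = 1) (c : ℝ) :
    Φ (algebraMap ℝ 𝔄 c) = algebraMap ℝ (K →L[ℂ] K) c := by
  rw [Algebra.algebraMap_eq_smul_one, Algebra.algebraMap_eq_smul_one, real_smul, hΦ1]

lemma strict_add {𝔅 : Type*} [CStarAlgebra 𝔅] [PartialOrder 𝔅] [StarOrderedRing 𝔅]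
    {t : ℝ} (ht : 0 < t) (X : 𝔅) (hX : 0 ≤ X) : IsStrictlyPositive (algebraMap ℝ 𝔅 t + X) := by
  refine IsStrictlyPositive.add_nonneg ?_ hX
  rw [Algebra.algebraMap_eq_smul_one]
  exact ⟨smul_nonneg ht.le zero_le_one, (isUnit_one).smul (Units.mk0 t ht.ne')⟩

lemma jen_res (Φ : 𝔄 →ₗ[ℂ] (K →L[ℂ] K)) (hΦ : ∀ T, 0 ≤ T → 0 ≤ Φ T) (hΦ1 : Φ 1 = 1)
    (X : 𝔄) (hX : 0 ≤ X) {t : ℝ} (ht : 0 < t) :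
    Ring.inverse (algebraMap ℝ (K →L[ℂ] K) t + Φ X) ≤ Φ (Ring.inverse (algebraMap ℝ 𝔄 t + X)) := by
  have h := jen_inv Φ hΦ hΦ1 _ (strict_add ht X hX)
  rw [CFC.inverse_eq_rpow_neg_one (strict_add ht X hX),
    CFC.inverse_eq_rpow_neg_one (strict_add ht _ (hΦ _ hX))]
  rwa [map_add, real_alg Φ hΦ1] at h

lemma cont_inv {t : ℝ} (ht : 0 < t) : ContinuousOn (fun z : ℝ => (t + z)⁻¹) (Set.Ici 0) := by
  refine ContinuousOn.inv₀ (by fun_prop) fun z hz => ?_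
  have : (0:ℝ) ≤ z := hz
  linarith

lemma cfc_resolvent {𝔅 : Type*} [CStarAlgebra 𝔅] [PartialOrder 𝔅] [StarOrderedRing 𝔅]
    {t : ℝ} (ht : 0 < t) (x : 𝔅) (hx : 0 ≤ x) :
    cfc (fun z : ℝ => (t + z)⁻¹) x = Ring.inverse (algebraMap ℝ 𝔅 t + x) := by
  have hspectrum :  ∀ r ∈ spectrum ℝ x, t + r ≠ 0 := by
    intro r hr
    have := spectrum_nonneg_of_nonneg hx hr
    linarith
  rw [cfc_inv (fun z : ℝ => t + z) x hspectrum (by fun_prop) hx.isSelfAdjoint,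
    cfc_const_add t (fun z : ℝ => z) x (by fun_prop) hx.isSelfAdjoint,
    cfc_id' ℝ x hx.isSelfAdjoint]

open Real in
lemma cfc01 {𝔅 : Type*} [CStarAlgebra 𝔅] [PartialOrder 𝔅] [StarOrderedRing 𝔅]
    {p t : ℝ} (hp : p ∈ Set.Ioo (0:ℝ) 1) (ht : 0 < t) (x : 𝔅) (hx : 0 ≤ x) :
    cfcₙ (rpowIntegrand₀₁ p t) x =
      algebraMap ℝ 𝔅 (t ^ (p - 1)) - t ^ p • Ring.inverse (algebraMap ℝ 𝔅 t + x) := by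
  have hs : spectrum ℝ x ⊆ Set.Ici 0 := fun r hr => spectrum_nonneg_of_nonneg hx hr
  have hq : quasispectrum ℝ x ⊆ Set.Ici 0 := fun r hr => quasispectrum_nonneg_of_nonneg x hx r hr
  have hg := (cont_inv ht).mono hs
  have hg2 : ContinuousOn (fun z : ℝ => t ^ p * (t + z)⁻¹) (spectrum ℝ x) := continuousOn_const.mul hg
  rw [cfcₙ_eq_cfc (hf := (continuousOn_rpowIntegrand₀₁_Ici hp ht).mono hq)
    (hf0 := rpowIntegrand₀₁_zero_right), rpowIntegrand₀₁_eq_sub (by grind) ht,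
    cfc_sub (fun _ : ℝ => t ^ (p - 1)) (fun z : ℝ => t ^ p * (t + z)⁻¹) x continuousOn_const hg2,
    cfc_const _ _ hx.isSelfAdjoint, cfc_const_mul _ _ _ hg, cfc_resolvent ht x hx]

open Real in
lemma cfc12 {𝔅 : Type*} [CStarAlgebra 𝔅] [PartialOrder 𝔅] [StarOrderedRing 𝔅]
    {p t : ℝ} (ht : 0 < t) (x : 𝔅) (hx : 0 ≤ x) :
    cfcₙ (rpowIntegrand₁₂ p t) x =
      (t ^ (p - 1) * t⁻¹) • x + (t ^ (p - 1) * t) • Ring.inverse (algebraMap ℝ 𝔅 t + x)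
        - algebraMap ℝ 𝔅 (t ^ (p - 1)) := by
  have hs : spectrum ℝ x ⊆ Set.Ici 0 := fun r hr => spectrum_nonneg_of_nonneg hx hr
  have hq : quasispectrum ℝ x ⊆ Set.Ici 0 := fun r hr => quasispectrum_nonneg_of_nonneg x hx r hr
  have e : rpowIntegrand₁₂ p t = fun z : ℝ => ((t ^ (p - 1) * t⁻¹) * z +
      (t ^ (p - 1) * t) * (t + z)⁻¹) - t ^ (p - 1) := by
    ext z; unfold rpowIntegrand₁₂; ring
  have c1 : Continuous (fun z : ℝ => (t ^ (p - 1) * t⁻¹) * z) := by fun_prop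
  have c2 : ContinuousOn (fun z : ℝ => (t ^ (p - 1) * t) * (t + z)⁻¹) (Set.Ici 0) :=
    continuousOn_const.mul (cont_inv ht)
  have c3 : ContinuousOn (fun z : ℝ => (t ^ (p - 1) * t⁻¹) * z +
      (t ^ (p - 1) * t) * (t + z)⁻¹) (Set.Ici 0) := c1.continuousOn.add c2
  have c4 : ContinuousOn (rpowIntegrand₁₂ p t) (Set.Ici 0) := by
    rw [e]; exact c3.sub continuousOn_const
  rw [cfcₙ_eq_cfc (hf := c4.mono hq) (hf0 := rpowIntegrand₁₂_zero ht), e,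
    cfc_sub (fun z : ℝ => ((t ^ (p - 1) * t⁻¹) * z +
      (t ^ (p - 1) * t) * (t + z)⁻¹)) (fun _ => t ^ (p - 1)) x (c3.mono hs) continuousOn_const,
    cfc_const _ _ hx.isSelfAdjoint,
    cfc_add (a := x) (fun z : ℝ => (t ^ (p - 1) * t⁻¹) * z)
      (fun z : ℝ => (t ^ (p - 1) * t) * (t + z)⁻¹) c1.continuousOn (c2.mono hs),
    cfc_const_mul _ (fun z : ℝ => z) _ continuousOn_id,
    cfc_const_mul _ _ _ ((cont_inv ht).mono hs),
    cfc_resolvent ht x hx, cfc_id' ℝ x hx.isSelfAdjoint]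

open MeasureTheory

lemma Phi_mono (Φ : 𝔄 →ₗ[ℂ] (K →L[ℂ] K)) (hΦ : ∀ T, 0 ≤ T → 0 ≤ Φ T) : Monotone Φ := by
  intro a b hab
  have := hΦ _ (sub_nonneg.2 hab)
  rwa [map_sub, sub_nonneg] at this

lemma Phi_cont (Φ : 𝔄 →ₗ[ℂ] (K →L[ℂ] K)) (hΦ : ∀ T, 0 ≤ T → 0 ≤ Φ T) : Continuous Φ := by
  let Ψ : 𝔄 →ₚ[ℂ] (K →L[ℂ] K) := { Φ with monotone' := Phi_mono Φ hΦ }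
  exact map_continuous Ψ

lemma int_le (Φ : 𝔄 →ₗ[ℂ] (K →L[ℂ] K)) (hΦ : ∀ T, 0 ≤ T → 0 ≤ Φ T)
    (μ : Measure ℝ) (G : ℝ → 𝔄) (F : ℝ → (K →L[ℂ] K)) (hG : IntegrableOn G (Set.Ioi 0) μ)
    (hF : IntegrableOn F (Set.Ioi 0) μ)
    (u : 𝔄) (v : K →L[ℂ] K) (hu : u = ∫ t in Set.Ioi 0, G t ∂μ)
    (hv : v = ∫ t in Set.Ioi 0, F t ∂μ) :
    ((∀ t, 0 < t → Φ (G t) ≤ F t) → Φ u ≤ v) ∧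
    ((∀ t, 0 < t → F t ≤ Φ (G t)) → v ≤ Φ u) := by
  let L : 𝔄 →L[ℂ] (K →L[ℂ] K) := ⟨Φ, Phi_cont Φ hΦ⟩
  have i1 : Φ u = ∫ t in Set.Ioi 0, L (G t) ∂μ := by
    rw [L.integral_comp_comm hG, ← hu]; rfl
  have j1 : IntegrableOn (fun t => L (G t)) (Set.Ioi 0) μ := L.integrable_comp hG
  constructor
  · intro h
    rw [i1, hv]
    refine integral_mono_ae j1 hF ?_
    filter_upwards [ae_restrict_mem measurableSet_Ioi] with t ht using h t ht
  · intro h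
    rw [i1, hv]
    refine integral_mono_ae hF j1 ?_
    filter_upwards [ae_restrict_mem measurableSet_Ioi] with t ht using h t ht

/-- The integral representation lifts from scalars to a C*-algebra, keeping the measure. -/
lemma rep_lift {𝔅 : Type*} [CStarAlgebra 𝔅] [PartialOrder 𝔅] [StarOrderedRing 𝔅]
    {p : ℝ≥0} (f : ℝ → ℝ → ℝ) (μ : Measure ℝ)
    (hμ : ∀ x : ℝ, 0 ≤ x → IntegrableOn (fun t => f t x) (Set.Ioi 0) μ ∧
      x ^ (p:ℝ) = ∫ t in Set.Ioi 0, f t x ∂μ)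
    (h0 : ∀ t, 0 < t → f t 0 = 0)
    (hnn : ∀ t, 0 < t → ∀ x, 0 ≤ x → 0 ≤ f t x)
    (hmono : ∀ t, 0 < t → MonotoneOn (f t) (Set.Ici 0))
    (hcont : ∀ s : Set ℝ, s ⊆ Set.Ici 0 →
      ContinuousOn (Function.uncurry f) (Set.Ioi (0 : ℝ) ×ˢ s))
    (a : 𝔅) (ha : 0 ≤ a) :
    IntegrableOn (fun t => cfcₙ (f t) a) (Set.Ioi 0) μ ∧
      a ^ p = ∫ t in Set.Ioi 0, cfcₙ (f t) a ∂μ := by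
  have hq : quasispectrum ℝ a ⊆ Set.Ici 0 := fun r hr => quasispectrum_nonneg_of_nonneg a ha r hr
  let maxr := sSup (quasispectrum ℝ a)
  have maxr_nonneg : 0 ≤ maxr :=
    le_csSup_of_le (b := 0) (IsCompact.bddAbove (quasispectrum.isCompact _)) (by simp) le_rfl
  let bound (t : ℝ) := ‖f t maxr‖
  have hf := hcont _ hq
  have hbound : ∀ᵐ t ∂μ.restrict (Set.Ioi 0), ∀ z ∈ quasispectrum ℝ a, ‖f t z‖ ≤ bound t := by
    filter_upwards [ae_restrict_mem measurableSet_Ioi] with t ht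
    intro z hz
    have hz' : 0 ≤ z := hq hz
    unfold bound
    rw [Real.norm_of_nonneg (hnn t ht z hz'), Real.norm_of_nonneg (hnn t ht _ maxr_nonneg)]
    refine hmono t ht hz' maxr_nonneg ?_
    exact le_csSup (IsCompact.bddAbove (quasispectrum.isCompact _)) hz
  have hfin : HasFiniteIntegral bound (μ.restrict (Set.Ioi 0)) := by
    rw [hasFiniteIntegral_norm_iff]
    exact (hμ maxr maxr_nonneg).1.2
  have hmapzero : ∀ᵐ (x : ℝ) ∂μ.restrict (Set.Ioi 0), f x 0 = 0 := by
    filter_upwards [ae_restrict_mem measurableSet_Ioi] with t ht using h0 t ht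
  refine ⟨integrableOn_cfcₙ measurableSet_Ioi _ bound a hf hmapzero hbound hfin
    ha.isSelfAdjoint, ?_⟩
  calc a ^ p = cfcₙ (fun r => ∫ t in Set.Ioi 0, f t r ∂μ) a := by
        rw [CFC.nnrpow_eq_cfcₙ_real _ _]
        exact cfcₙ_congr fun r hr ↦ (hμ r (hq hr)).2
    _ = _ := cfcₙ_setIntegral measurableSet_Ioi _ bound a hf hmapzero hbound hfin
        ha.isSelfAdjoint

open Real in
lemma jen01 (Φ : 𝔄 →ₗ[ℂ] (K →L[ℂ] K)) (hΦ : ∀ T, 0 ≤ T → 0 ≤ Φ T) (hΦ1 : Φ 1 = 1)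
    (X : 𝔄) (hX : 0 ≤ X) {r : ℝ} (h0 : 0 < r) (h1 : r ≤ 1) : Φ (X ^ r) ≤ (Φ X) ^ r := by
  rcases h1.eq_or_lt with rfl | h1
  · rw [CFC.rpow_one X hX, CFC.rpow_one _ (hΦ X hX)]
  lift r to ℝ≥0 using h0.le
  have hr0 : 0 < r := by exact_mod_cast h0
  have hp' : (r:ℝ) ∈ Set.Ioo (0:ℝ) 1 := ⟨h0, h1⟩
  obtain ⟨μ, hμ⟩ := exists_measure_rpow_eq_integral_rpowIntegrand₀₁ hp'
  obtain ⟨a1, a2⟩ := rep_lift (rpowIntegrand₀₁ r) μ hμ (fun t _ => rpowIntegrand₀₁_zero_right)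
      (fun t ht x hx => rpowIntegrand₀₁_nonneg h0 ht.le hx)
      (fun t ht => rpowIntegrand₀₁_monotoneOn hp' ht.le)
      (fun s hs => continuousOn_rpowIntegrand₀₁_uncurry hp' s hs) X hX
  obtain ⟨b1, b2⟩ := rep_lift (rpowIntegrand₀₁ r) μ hμ (fun t _ => rpowIntegrand₀₁_zero_right)
      (fun t ht x hx => rpowIntegrand₀₁_nonneg h0 ht.le hx)
      (fun t ht => rpowIntegrand₀₁_monotoneOn hp' ht.le)
      (fun s hs => continuousOn_rpowIntegrand₀₁_uncurry hp' s hs) (Φ X) (hΦ X hX)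
  rw [← CFC.nnrpow_eq_rpow hr0, ← CFC.nnrpow_eq_rpow hr0]
  refine (int_le Φ hΦ μ _ _ a1 b1 _ _ a2 b2).1 fun t ht => ?_
  rw [cfc01 hp' ht _ hX, cfc01 hp' ht _ (hΦ X hX), map_sub, real_alg Φ hΦ1, real_smul]
  exact sub_le_sub_left (smul_le_smul_of_nonneg_left (jen_res Φ hΦ hΦ1 X hX ht) (by positivity)) _

open Real in
lemma jen12 (Φ : 𝔄 →ₗ[ℂ] (K →L[ℂ] K)) (hΦ : ∀ T, 0 ≤ T → 0 ≤ Φ T) (hΦ1 : Φ 1 = 1)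
    (X : 𝔄) (hX : 0 ≤ X) {r : ℝ} (h1 : 1 < r) (h2 : r ≤ 2) : (Φ X) ^ r ≤ Φ (X ^ r) := by
  rcases h2.eq_or_lt with rfl | h2
  · have := kadison Φ hΦ hΦ1 X hX
    rw [← CFC.rpow_natCast X 2 hX, ← CFC.rpow_natCast (Φ X) 2 (hΦ X hX)] at this
    exact_mod_cast this
  have h0 : 0 < r := by linarith
  lift r to ℝ≥0 using h0.le
  have hr0 : 0 < r := by exact_mod_cast h0
  have hp' : (r:ℝ) ∈ Set.Ioo (1:ℝ) 2 := ⟨h1, h2⟩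
  obtain ⟨μ, hμ⟩ := exists_measure_rpow_eq_integral_rpowIntegrand₁₂ hp'
  obtain ⟨a1, a2⟩ := rep_lift (rpowIntegrand₁₂ r) μ hμ (fun t ht => rpowIntegrand₁₂_zero ht)
      (fun t ht x hx => rpowIntegrand₁₂_nonneg (by grind) (by grind) hx)
      (fun t ht => monotoneOn_rpowIntegrand₁₂ (by grind) (by grind))
      (fun s hs => continuousOn_rpowIntegrand₁₂_uncurry hp'.1 s hs) X hX
  obtain ⟨b1, b2⟩ := rep_lift (rpowIntegrand₁₂ r) μ hμ (fun t ht => rpowIntegrand₁₂_zero ht)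
      (fun t ht x hx => rpowIntegrand₁₂_nonneg (by grind) (by grind) hx)
      (fun t ht => monotoneOn_rpowIntegrand₁₂ (by grind) (by grind))
      (fun s hs => continuousOn_rpowIntegrand₁₂_uncurry hp'.1 s hs) (Φ X) (hΦ X hX)
  rw [← CFC.nnrpow_eq_rpow hr0, ← CFC.nnrpow_eq_rpow hr0]
  refine (int_le Φ hΦ μ _ _ a1 b1 _ _ a2 b2).2 fun t ht => ?_
  rw [cfc12 ht _ hX, cfc12 ht _ (hΦ X hX), map_sub, map_add, real_alg Φ hΦ1, real_smul, real_smul]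
  exact sub_le_sub_right (add_le_add_right
    (smul_le_smul_of_nonneg_left (jen_res Φ hΦ hΦ1 X hX ht) (by positivity)) _) _

lemma rpow_strict {𝔅 : Type*} [CStarAlgebra 𝔅] [PartialOrder 𝔅] [StarOrderedRing 𝔅]
    {a : 𝔅} (ha : IsStrictlyPositive a) (r : ℝ) : IsStrictlyPositive (a ^ r) :=
  ⟨CFC.rpow_nonneg, ha.isUnit.cfcRpow r ha.nonneg⟩

lemma anti {𝔅 : Type*} [CStarAlgebra 𝔅] [PartialOrder 𝔅] [StarOrderedRing 𝔅]
    {a b : 𝔅} (ha : IsStrictlyPositive a) (hab : a ≤ b) {r : ℝ} (h1 : -1 ≤ r) (h0 : r < 0) :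
    b ^ r ≤ a ^ r := by
  have hb : IsStrictlyPositive b := ha.of_le hab
  have h := CStarAlgebra.rpow_neg_one_le_rpow_neg_one (CFC.rpow_le_rpow (p := -r)
    ⟨by linarith, by linarith⟩ hab) (rpow_strict ha _)
  rw [CFC.rpow_rpow a _ _ (by linarith) ha, CFC.rpow_rpow b _ _ (by linarith) hb] at h
  simpa using h

lemma jen_neg (Φ : 𝔄 →ₗ[ℂ] (K →L[ℂ] K)) (hΦ : ∀ T, 0 ≤ T → 0 ≤ Φ T) (hΦ1 : Φ 1 = 1)
    (X : 𝔄) (hX : IsStrictlyPositive X) {r : ℝ} (h1 : -1 ≤ r) (h0 : r < 0) :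
    (Φ X) ^ r ≤ Φ (X ^ r) := by
  have hP := map_strict Φ hΦ hΦ1 X hX
  have a := jen01 Φ hΦ hΦ1 X hX.nonneg (r := -r) (by linarith) (by linarith)
  have b := anti (map_strict Φ hΦ hΦ1 _ (rpow_strict hX (-r))) a (r := -1) le_rfl (by norm_num)
  have c := jen_inv Φ hΦ hΦ1 _ (rpow_strict hX (-r))
  have d := b.trans c
  rw [CFC.rpow_rpow _ _ _ (by linarith) hP, CFC.rpow_rpow _ _ _ (by linarith) hX] at d
  simpa using d

lemma case2 (Φ : 𝔄 →ₗ[ℂ] (K →L[ℂ] K)) (hΦ : ∀ T, 0 ≤ T → 0 ≤ Φ T) (hΦ1 : Φ 1 = 1)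
    (A : 𝔄) (hA : IsStrictlyPositive A) {p q : ℝ} (h1 : 1 ≤ p) (h : p ≤ q) :
    (Φ (A ^ p)) ^ (1 / p) ≤ (Φ (A ^ q)) ^ (1 / q) := by
  have hp : 0 < p := by linarith
  have hq : 0 < q := by linarith
  have a := jen01 Φ hΦ hΦ1 (A ^ q) CFC.rpow_nonneg (r := p / q) (by positivity)
    ((div_le_one hq).2 h)
  rw [CFC.rpow_rpow _ _ _ hq.ne' hA, mul_div_cancel₀ p hq.ne'] at a
  have b := CFC.rpow_le_rpow (p := 1 / p) ⟨by positivity, (div_le_one hp).2 h1⟩ a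
  rw [CFC.rpow_rpow _ _ _ (by positivity)
    (map_strict Φ hΦ hΦ1 _ (rpow_strict hA q))] at b
  convert b using 2
  field_simp

lemma case3 (Φ : 𝔄 →ₗ[ℂ] (K →L[ℂ] K)) (hΦ : ∀ T, 0 ≤ T → 0 ≤ Φ T) (hΦ1 : Φ 1 = 1)
    (A : 𝔄) (hA : IsStrictlyPositive A) {p q : ℝ} (h1 : q ≤ -1) (h : p ≤ q) :
    (Φ (A ^ p)) ^ (1 / p) ≤ (Φ (A ^ q)) ^ (1 / q) := by
  have hp : p < 0 := by linarith
  have hq : q < 0 := by linarith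
  have a := jen01 Φ hΦ hΦ1 (A ^ p) CFC.rpow_nonneg (r := q / p) (div_pos_of_neg_of_neg hq hp)
    ((div_le_one_of_neg hp).2 h)
  rw [CFC.rpow_rpow _ _ _ hp.ne hA, mul_div_cancel₀ q hp.ne] at a
  have b := anti (map_strict Φ hΦ hΦ1 _ (rpow_strict hA q)) a (r := 1 / q)
    (by rw [le_div_iff_of_neg hq]; linarith) (one_div_neg.2 hq)
  rw [CFC.rpow_rpow _ _ _ (div_pos_of_neg_of_neg hq hp).ne'
    (map_strict Φ hΦ hΦ1 _ (rpow_strict hA p))] at b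
  convert b using 2
  have := hp.ne
  have := hq.ne
  field_simp

lemma main (Φ : 𝔄 →ₗ[ℂ] (K →L[ℂ] K)) (hΦ : ∀ T, 0 ≤ T → 0 ≤ Φ T) (hΦ1 : Φ 1 = 1)
    (A : 𝔄) (hA : IsStrictlyPositive A) {p q : ℝ}
    (hpq : p = q ∨ (1 ≤ p ∧ p < q) ∨ (p < q ∧ q ≤ -1) ∨ (p ≤ -1 ∧ 1 ≤ q) ∨
    (1/2 ≤ p ∧ p < 1 ∧ 1 ≤ q) ∨ (p ≤ -1 ∧ -1 < q ∧ q ≤ -1/2)) :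
    (Φ (A ^ p)) ^ (1 / p) ≤ (Φ (A ^ q)) ^ (1 / q) := by
  have toOne : 1 ≤ q → Φ A ≤ (Φ (A ^ q)) ^ (1 / q) := fun hq => by
    have := case2 Φ hΦ hΦ1 A hA le_rfl hq
    rwa [CFC.rpow_one A hA.nonneg, div_one, CFC.rpow_one _ (hΦ A hA.nonneg)] at this
  rcases hpq with rfl | ⟨h1, h2⟩ | ⟨h1, h2⟩ | ⟨h1, h2⟩ | ⟨h1, h2, h3⟩ | ⟨h1, h2, h3⟩
  · exact le_rfl
  · exact case2 Φ hΦ hΦ1 A hA h1 h2.le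
  · exact case3 Φ hΦ hΦ1 A hA h2 h1.le
  · have hp : p < 0 := by linarith
    refine le_trans ?_ (toOne h2)
    have := jen_neg Φ hΦ hΦ1 (A ^ p) (rpow_strict hA p) (r := 1 / p)
      (by rw [le_div_iff_of_neg hp]; linarith) (one_div_neg.2 hp)
    rwa [CFC.rpow_rpow _ _ _ hp.ne hA, mul_one_div_cancel hp.ne, CFC.rpow_one A hA.nonneg] at this
  · have hp : 0 < p := by linarith
    refine le_trans ?_ (toOne h3)
    have := jen12 Φ hΦ hΦ1 (A ^ p) CFC.rpow_nonneg (r := 1 / p)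
      (by rw [lt_div_iff₀ hp]; linarith) (by rw [div_le_iff₀ hp]; linarith)
    rwa [CFC.rpow_rpow _ _ _ hp.ne' hA, mul_one_div_cancel hp.ne', CFC.rpow_one A hA.nonneg] at this
  · have hq : q < 0 := by linarith
    have hq2 : 0 < -q := by linarith
    have a := case3 Φ hΦ hΦ1 A hA le_rfl h1
    refine a.trans ?_
    have b := jen12 Φ hΦ hΦ1 (A ^ q) CFC.rpow_nonneg (r := 1 / (-q))
      (by rw [lt_div_iff₀ hq2]; linarith) (by rw [div_le_iff₀ hq2]; linarith)
    have hs := map_strict Φ hΦ hΦ1 _ (rpow_strict hA q)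
    rw [CFC.rpow_rpow _ _ _ hq.ne hA, show q * (1 / (-q)) = -1 by
      have := hq.ne
      field_simp] at b
    have c := anti (rpow_strict hs _) b (r := -1) le_rfl (by norm_num)
    rw [CFC.rpow_rpow _ _ _ (by positivity) hs, show 1 / (-q) * (-1) = 1 / q by
      have := hq.ne
      field_simp] at c
    rwa [show (1:ℝ) / (-1) = -1 by norm_num]

end jensen

end PM

/-- If `Φ : B(H) → B(K)` is a unital positive linear map, `p, q` are nonzero reals
satisfying condition (★), and `A ∈ B(H)` is positive invertible, then
`Φ(A^p)^(1/p) ≤ Φ(A^q)^(1/q)` (real powers via the continuous functional calculus,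
`≤` being the Loewner order). -/
theorem powerMean_op_inequality
    {H K : Type*} [NormedAddCommGroup H] [InnerProductSpace ℂ H] [CompleteSpace H]
    [NormedAddCommGroup K] [InnerProductSpace ℂ K] [CompleteSpace K]
    (Φ : (H →L[ℂ] H) →ₗ[ℂ] (K →L[ℂ] K))
    (hΦpos : ∀ T : H →L[ℂ] H, 0 ≤ T → 0 ≤ Φ T)
    (hΦ1 : Φ 1 = 1)
    (p q : ℝ) (hp : p ≠ 0) (hq : q ≠ 0) (hpq : StarCond p q)
    (A : H →L[ℂ] H) (hA : 0 ≤ A) (hAinv : IsUnit A) :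
    (Φ (A ^ p)) ^ (1 / p) ≤ (Φ (A ^ q)) ^ (1 / q) := by
  exact PM.main Φ hΦpos hΦ1 A ⟨hA, hAinv⟩ hpq
end

section
/- Let H₁, H₂, K be complex Hilbert spaces and let Φᵢ : B(Hᵢ) → B(K), i = 1, 2, be positive linear maps such that Φ₁(I_{H₁}) + Φ₂(I_{H₂}) = I_K. Let p, q be nonzero real numbers satisfying condition (★). Then for every positive invertible A ∈ B(H₁) and positive invertible B ∈ B(H₂), one has (Φ₁(A^p) + Φ₂(B^p))^{1/p} ≤ (Φ₁(A^q) + Φ₂(B^q))^{1/q}. -/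
section J
open scoped unitInterval InnerProductSpace NNReal
open Filter Topology
set_option linter.unusedSectionVars false
variable {K : Type*} [NormedAddCommGroup K] [InnerProductSpace ℂ K] [CompleteSpace K]

/-- The quadratic form attached to `Ψ` and `u, v, w`. -/
theorem bernstein_form (Ψ : C(I, ℝ) →L[ℝ] (K →L[ℂ] K)) (hΨ : ∀ φ, 0 ≤ φ → 0 ≤ Ψ φ)
    (f g : C(I, ℝ)) (x y : K) :
    0 ≤ RCLike.re ⟪Ψ (f * f) x, x⟫_ℂ + RCLike.re ⟪Ψ (f * g) x, y⟫_ℂ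
      + RCLike.re ⟪Ψ (f * g) y, x⟫_ℂ + RCLike.re ⟪Ψ (g * g) y, y⟫_ℂ := by
  have hc : ∀ (φ : C(I, ℝ)) (u v : K), Tendsto
      (fun n => RCLike.re ⟪Ψ (bernsteinApproximation n φ) u, v⟫_ℂ) atTop
      (𝓝 (RCLike.re ⟪Ψ φ u, v⟫_ℂ)) := by
    intro φ u v
    have h : Continuous (fun φ : C(I, ℝ) => RCLike.re ⟪Ψ φ u, v⟫_ℂ) := by fun_prop
    exact (h.tendsto φ).comp (bernsteinApproximation_uniform φ)
  refine ge_of_tendsto' ((((hc (f * f) x x).add (hc (f * g) x y)).add (hc (f * g) y x)).add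
    (hc (g * g) y y)) ?_
  intro n
  have hb : ∀ φ : C(I, ℝ), bernsteinApproximation n φ =
      ∑ k : Fin (n + 1), φ (bernstein.z k) • bernstein n k := by
    intro φ
    ext t
    simp [bernsteinApproximation.apply, mul_comm]
  have hs : ∀ (φ : C(I, ℝ)) (u v : K), RCLike.re ⟪Ψ (bernsteinApproximation n φ) u, v⟫_ℂ =
      ∑ k : Fin (n + 1), φ (bernstein.z k) * RCLike.re ⟪Ψ (bernstein n k) u, v⟫_ℂ := by
    intro φ u v
    rw [hb, map_sum, sum_apply, sum_inner, map_sum]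
    refine Finset.sum_congr rfl fun k _ => ?_
    rw [map_smul, smul_apply, inner_smul_left_eq_smul, RCLike.smul_re]
  simp only [hs]
  rw [← Finset.sum_add_distrib, ← Finset.sum_add_distrib, ← Finset.sum_add_distrib]
  refine Finset.sum_nonneg fun k _ => ?_
  have hpos : 0 ≤ Ψ (bernstein n k) := hΨ _ (fun t => bernstein_nonneg)
  rw [ContinuousLinearMap.nonneg_iff_isPositive] at hpos
  have := hpos.re_inner_nonneg_left (f (bernstein.z k) • x + g (bernstein.z k) • y)
  simp only [map_add, inner_add_left, inner_add_right, ContinuousLinearMap.map_smul_of_tower,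
    inner_smul_left_eq_smul, inner_smul_right_eq_smul, RCLike.smul_re, ContinuousMap.mul_apply] at this ⊢
  linarith

variable {𝒜 : Type*} [CStarAlgebra 𝒜] [PartialOrder 𝒜] [StarOrderedRing 𝒜]

theorem posmap_continuous (Φ : 𝒜 →ₗ[ℂ] (K →L[ℂ] K)) (hΦ : ∀ T, 0 ≤ T → 0 ≤ Φ T) :
    Continuous Φ :=
  map_continuous (PositiveLinearMap.mk₀ Φ hΦ)

theorem cfc_form (Φ : 𝒜 →ₗ[ℂ] (K →L[ℂ] K)) (hΦ : ∀ T, 0 ≤ T → 0 ≤ Φ T)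
    (a : 𝒜) (ha : IsSelfAdjoint a) (f g : C(spectrum ℝ a, ℝ)) (x y : K) :
    0 ≤ RCLike.re ⟪Φ (cfcHom ha (f * f)) x, x⟫_ℂ + RCLike.re ⟪Φ (cfcHom ha (f * g)) x, y⟫_ℂ
      + RCLike.re ⟪Φ (cfcHom ha (f * g)) y, x⟫_ℂ
      + RCLike.re ⟪Φ (cfcHom ha (g * g)) y, y⟫_ℂ := by
  have hcpt : IsCompact (spectrum ℝ a) := ContinuousFunctionalCalculus.isCompact_spectrum a
  have : CompactSpace (spectrum ℝ a) := isCompact_iff_compactSpace.mp hcpt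
  obtain ⟨R, hR⟩ := hcpt.isBounded.subset_closedBall 0
  set c := |R| + 1 with hcdef
  have hc : 0 < c := by positivity
  have hmem : ∀ t : spectrum ℝ a, (t.1 / c + 1) / 2 ∈ I := by
    intro t
    have h1 := hR t.2
    rw [mem_closedBall_zero_iff, Real.norm_eq_abs] at h1
    have h2 : |t.1 / c| ≤ 1 := by
      rw [abs_div, abs_of_pos hc, div_le_one hc]
      linarith [le_abs_self R]
    rw [abs_le] at h2
    constructor <;> linarith
  let ρ : C(spectrum ℝ a, I) := ⟨fun t => ⟨(t.1 / c + 1) / 2, hmem t⟩, by fun_prop⟩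
  have hρ : IsClosedEmbedding ρ := by
    refine ρ.continuous.isClosedEmbedding ?_
    intro s t hst
    have := congrArg Subtype.val hst
    simp only [ρ, ContinuousMap.coe_mk] at this
    have h2 : s.1 / c = t.1 / c := by linarith
    exact Subtype.ext ((div_left_inj' hc.ne').mp h2)
  obtain ⟨F, hF⟩ := ContinuousMap.exists_extension hρ f
  obtain ⟨G, hG⟩ := ContinuousMap.exists_extension hρ g
  let L : C(I, ℝ) →ₗ[ℝ] (K →L[ℂ] K) :=
    (Φ.restrictScalars ℝ) ∘ₗ (cfcHom ha (R := ℝ)).toAlgHom.toLinearMap ∘ₗ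
      (ContinuousMap.compRightAlgHom ℝ ℝ ρ).toLinearMap
  have hL : ∀ φ : C(I, ℝ), L φ = Φ (cfcHom ha (φ.comp ρ)) := fun φ => rfl
  have hLc : Continuous L := by
    refine (posmap_continuous Φ hΦ).comp ((cfcHom_continuous ha).comp ?_)
    exact ContinuousMap.continuous_precomp ρ
  have := bernstein_form ⟨L, hLc⟩ ?_ F G x y
  · have e1 : (F * F).comp ρ = f * f := by rw [← hF]; rfl
    have e2 : (F * G).comp ρ = f * g := by rw [← hF, ← hG]; rfl
    have e3 : (G * G).comp ρ = g * g := by rw [← hG]; rfl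
    simpa only [ContinuousLinearMap.coe_mk', hL, e1, e2, e3] using this
  · intro φ hφ
    change 0 ≤ L φ
    rw [hL]
    refine hΦ _ ?_
    rw [cfcHom_nonneg_iff]
    intro t
    exact hφ (ρ t)

theorem op_le_of_re {S T : K →L[ℂ] K} (hS : IsSelfAdjoint S) (hT : IsSelfAdjoint T)
    (h : ∀ y, RCLike.re ⟪S y, y⟫_ℂ ≤ RCLike.re ⟪T y, y⟫_ℂ) : S ≤ T := by
  rw [ContinuousLinearMap.le_def, ContinuousLinearMap.isPositive_def']
  refine ⟨hT.sub hS, fun y => ?_⟩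
  rw [ContinuousLinearMap.reApplyInnerSelf_apply, sub_apply, inner_sub_left,
    map_sub]
  linarith [h y]

theorem kadison_sq (Φ : 𝒜 →ₗ[ℂ] (K →L[ℂ] K)) (hΦ : ∀ T, 0 ≤ T → 0 ≤ Φ T) (h1 : Φ 1 = 1)
    (a : 𝒜) (ha : 0 ≤ a) : Φ a * Φ a ≤ Φ (a * a) := by
  have hsa : IsSelfAdjoint a := .of_nonneg ha
  have hP : IsSelfAdjoint (Φ a) := .of_nonneg (hΦ a ha)
  refine op_le_of_re ?_ (.of_nonneg (hΦ _ ?_)) fun y => ?_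
  · have := hP.mul_self_nonneg
    exact .of_nonneg this
  · exact hsa.mul_self_nonneg
  have := cfc_form Φ hΦ a hsa 1 (ContinuousMap.restrict (spectrum ℝ a) (.id ℝ)) (-(Φ a y)) y
  simp only [map_mul, map_one, mul_one, one_mul, h1, cfcHom_id] at this
  have e : ⟪Φ a (Φ a y), y⟫_ℂ = ⟪Φ a y, Φ a y⟫_ℂ := by
    rw [← ContinuousLinearMap.adjoint_inner_right, ← ContinuousLinearMap.star_eq_adjoint, hP.star_eq]
  simp only [one_apply_eq_self, map_neg, inner_neg_left, inner_neg_right, neg_neg, e,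
    mul_apply_eq_comp] at this ⊢
  linarith

theorem posmap_isStrictlyPositive (Φ : 𝒜 →ₗ[ℂ] (K →L[ℂ] K)) (hΦ : ∀ T, 0 ≤ T → 0 ≤ Φ T)
    (h1 : Φ 1 = 1) (a : 𝒜) (ha : IsStrictlyPositive a) : IsStrictlyPositive (Φ a) := by
  rcases subsingleton_or_nontrivial 𝒜 with h𝒜 | h𝒜
  · have h0 : (1 : K →L[ℂ] K) = 0 := by
      rw [← h1, Subsingleton.elim (1 : 𝒜) 0, map_zero]
    have : Φ a = 1 := by
      rw [← mul_one (Φ a), h0, mul_zero]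
    rw [this]
    exact isStrictlyPositive_one
  obtain ⟨r, hr, hra⟩ := (CFC.exists_pos_algebraMap_le_iff (a := a) ha.isSelfAdjoint).2
    (fun x hx => ha.spectrum_pos hx)
  have h := hΦ _ (sub_nonneg.2 hra)
  rw [map_sub, sub_nonneg, Algebra.algebraMap_eq_smul_one, ← Complex.coe_smul, map_smul, h1,
    Complex.coe_smul, ← Algebra.algebraMap_eq_smul_one] at h
  have : IsStrictlyPositive (algebraMap ℝ (K →L[ℂ] K) r) := by grind
  exact this.of_le h

theorem choi_inv (Φ : 𝒜 →ₗ[ℂ] (K →L[ℂ] K)) (hΦ : ∀ T, 0 ≤ T → 0 ≤ Φ T) (h1 : Φ 1 = 1)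
    (a : 𝒜) (ha : IsStrictlyPositive a) : Ring.inverse (Φ a) ≤ Φ (Ring.inverse a) := by
  have hsa : IsSelfAdjoint a := ha.isSelfAdjoint
  have hP := posmap_isStrictlyPositive Φ hΦ h1 a ha
  have hQ := hP.ringInverse
  have hspec : ∀ t : spectrum ℝ a, 0 < t.1 := fun t => ha.spectrum_pos t.2
  refine op_le_of_re hQ.isSelfAdjoint (.of_nonneg (hΦ _ ha.ringInverse.nonneg)) fun y => ?_
  let f : C(spectrum ℝ a, ℝ) := ⟨fun t => Real.sqrt t.1, by fun_prop⟩
  let g : C(spectrum ℝ a, ℝ) := ⟨fun t => (Real.sqrt t.1)⁻¹, by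
    refine Continuous.inv₀ (by fun_prop) fun t => (Real.sqrt_pos.2 (hspec t)).ne'⟩
  have e1 : f * f = ContinuousMap.restrict (spectrum ℝ a) (.id ℝ) := by
    ext t
    exact Real.mul_self_sqrt (hspec t).le
  have e2 : f * g = 1 := by
    ext t
    exact mul_inv_cancel₀ (Real.sqrt_pos.2 (hspec t)).ne'
  have e3 : cfcHom hsa (g * g) = Ring.inverse a := by
    have e4 : cfcHom hsa (f * f) = a := by rw [e1, cfcHom_id]
    have e5 : cfcHom hsa (g * g) * a = 1 := by
      refine (congrArg (cfcHom hsa (g * g) * ·) e4.symm).trans ?_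
      rw [← map_mul, show g * g * (f * f) = (f * g) * (f * g) by ring, e2, mul_one, map_one]
    calc _ = cfcHom hsa (g * g) * (a * Ring.inverse a) := by
            rw [Ring.mul_inverse_cancel _ ha.isUnit, mul_one]
      _ = _ := by rw [← mul_assoc, e5, one_mul]
  have := cfc_form Φ hΦ a hsa f g (-(Ring.inverse (Φ a) y)) y
  rw [e1, e2, e3, cfcHom_id, map_one, h1] at this
  have e : Φ a (Ring.inverse (Φ a) y) = y := by
    have := Ring.mul_inverse_cancel _ hP.isUnit
    simpa using congrArg (fun T : K →L[ℂ] K => T y) this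
  have e' : ⟪y, Ring.inverse (Φ a) y⟫_ℂ = ⟪Ring.inverse (Φ a) y, y⟫_ℂ := by
    rw [← ContinuousLinearMap.adjoint_inner_left, ← ContinuousLinearMap.star_eq_adjoint,
      hQ.isSelfAdjoint.star_eq]
  simp only [one_apply_eq_self, map_neg, inner_neg_left, inner_neg_right, neg_neg, e,
    e'] at this ⊢
  linarith

open CFC Real Set MeasureTheory

theorem cont_integrand12 {p t : ℝ} (ht : 0 < t) :
    ContinuousOn (rpowIntegrand₁₂ p t) (Ici 0) := by
  unfold rpowIntegrand₁₂
  have h : ContinuousOn (fun x : ℝ => (t + x)⁻¹) (Ici 0) :=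
    ContinuousOn.inv₀ (by fun_prop) (fun x hx => by
      have : (0:ℝ) ≤ x := hx
      positivity)
  exact continuousOn_const.mul ((((continuousOn_const.mul continuousOn_id)).add
    (continuousOn_const.mul h)).sub continuousOn_const)

theorem spec_nonneg (x : 𝒜) (hx : 0 ≤ x) : spectrum ℝ x ⊆ Ici 0 :=
  fun _ hr => spectrum_nonneg_of_nonneg hx hr

theorem qspec_nonneg (x : 𝒜) (hx : 0 ≤ x) : quasispectrum ℝ x ⊆ Ici 0 :=
  fun _ hr => quasispectrum_nonneg_of_nonneg x hx _ hr

theorem cfc_resolvent {t : ℝ} (ht : 0 < t) (x : 𝒜) (hx : 0 ≤ x) :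
    cfc (fun z : ℝ => (t + z)⁻¹) x = Ring.inverse (algebraMap ℝ 𝒜 t + x) := by
  have hsa : IsSelfAdjoint x := .of_nonneg hx
  have hspectrum : ∀ r ∈ spectrum ℝ x, t + r ≠ 0 := by
    intro r hr
    have : 0 ≤ r := spec_nonneg x hx hr
    positivity
  rw [cfc_inv (fun z : ℝ => t + z) x hspectrum (by fun_prop) hsa,
    cfc_const_add t (fun z : ℝ => z) x (by fun_prop) hsa, cfc_id' ℝ x hsa]

theorem cont_resolvent {t : ℝ} (ht : 0 < t) (x : 𝒜) (hx : 0 ≤ x) :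
    ContinuousOn (fun z : ℝ => (t + z)⁻¹) (spectrum ℝ x) :=
  ContinuousOn.inv₀ (by fun_prop) (fun r hr => by
      have : (0:ℝ) ≤ r := spec_nonneg x hx hr
      positivity)

theorem cfcn_integrand01 {p t : ℝ} (hp : p ∈ Ioo (0:ℝ) 1) (ht : 0 < t) (x : 𝒜) (hx : 0 ≤ x) :
    cfcₙ (rpowIntegrand₀₁ p t) x =
      algebraMap ℝ 𝒜 (t ^ (p - 1)) - t ^ p • Ring.inverse (algebraMap ℝ 𝒜 t + x) := by
  have hsa : IsSelfAdjoint x := .of_nonneg hx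
  have hg := cont_resolvent ht x hx
  have hc : ContinuousOn (rpowIntegrand₀₁ p t) (quasispectrum ℝ x) :=
    (continuousOn_rpowIntegrand₀₁_Ici hp ht).mono (qspec_nonneg x hx)
  rw [cfcₙ_eq_cfc hc rpowIntegrand₀₁_zero_right, rpowIntegrand₀₁_eq_sub hp.2.ne ht]
  have e1 := cfc_sub (R := ℝ) (fun _ : ℝ => t ^ (p - 1)) (fun z : ℝ => t ^ p * (t + z)⁻¹) x
    continuousOn_const (continuousOn_const.mul hg)
  have e2 := cfc_const_mul (R := ℝ) (t ^ p) (fun z : ℝ => (t + z)⁻¹) x hg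
  rw [e2, cfc_resolvent ht x hx, cfc_const (R := ℝ) _ x hsa] at e1
  exact e1

theorem cfcn_integrand12 {p t : ℝ} (ht : 0 < t) (x : 𝒜) (hx : 0 ≤ x) :
    cfcₙ (rpowIntegrand₁₂ p t) x =
      t ^ (p - 1) • (t⁻¹ • x + t • Ring.inverse (algebraMap ℝ 𝒜 t + x) - 1) := by
  have hsa : IsSelfAdjoint x := .of_nonneg hx
  have hg := cont_resolvent ht x hx
  have hc : ContinuousOn (rpowIntegrand₁₂ p t) (quasispectrum ℝ x) :=
    (cont_integrand12 ht).mono (qspec_nonneg x hx)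
  rw [cfcₙ_eq_cfc hc (rpowIntegrand₁₂_zero ht)]
  have c1 : ContinuousOn (fun z : ℝ => t⁻¹ * z) (spectrum ℝ x) := by fun_prop
  have c2 : ContinuousOn (fun z : ℝ => t * (t + z)⁻¹) (spectrum ℝ x) := continuousOn_const.mul hg
  have e1 := cfc_const_mul (R := ℝ) t⁻¹ (fun z : ℝ => z) x continuousOn_id
  have e2 := cfc_const_mul (R := ℝ) t (fun z : ℝ => (t + z)⁻¹) x hg
  have e3 := cfc_add (R := ℝ) (a := x) (fun z : ℝ => t⁻¹ * z) (fun z : ℝ => t * (t + z)⁻¹) c1 c2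
  have e4 := cfc_sub (R := ℝ) (fun z : ℝ => t⁻¹ * z + t * (t + z)⁻¹) (fun _ : ℝ => 1) x
    (c1.add c2) continuousOn_const
  have e5 := cfc_const_mul (R := ℝ) (t ^ (p - 1))
    (fun z : ℝ => t⁻¹ * z + t * (t + z)⁻¹ - 1) x ((c1.add c2).sub continuousOn_const)
  rw [e4, e3, e1, e2, cfc_resolvent ht x hx, cfc_id' ℝ x hsa, cfc_const (R := ℝ) _ x hsa,
    map_one] at e5
  exact e5

theorem jensen_core (Φ : 𝒜 →ₗ[ℂ] (K →L[ℂ] K)) (hΦ : ∀ T, 0 ≤ T → 0 ≤ Φ T)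
    (F : ℝ → ℝ → ℝ) (s : ℝ≥0)
    (hF : ∀ t, 0 < t → ContinuousOn (F t) (Ici 0))
    (μ : Measure ℝ) 
    (hμ : ∀ a ∈ Ici (0 : 𝒜 × (K →L[ℂ] K)),
      (IntegrableOn (fun t => cfcₙ (F t) a) (Ioi 0) μ)
      ∧ CFC.nnrpow a s = ∫ t in Ioi 0, cfcₙ (F t) a ∂μ)
    (a : 𝒜) (ha : 0 ≤ a) :
    (Φ a) ^ s - Φ (a ^ s) = ∫ t in Ioi 0, (cfcₙ (F t) (Φ a) - Φ (cfcₙ (F t) a)) ∂μ := by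
  have hPa := hΦ a ha
  have hX : (0 : 𝒜 × (K →L[ℂ] K)) ≤ (a, Φ a) := ⟨ha, hPa⟩
  obtain ⟨hi, he⟩ := hμ (a, Φ a) hX
  rw [nnrpow_map_prod ha hPa] at he
  let Φc : 𝒜 →L[ℝ] (K →L[ℂ] K) := ⟨Φ.restrictScalars ℝ, posmap_continuous Φ hΦ⟩
  let L : (𝒜 × (K →L[ℂ] K)) →L[ℝ] (K →L[ℂ] K) :=
    ContinuousLinearMap.snd ℝ 𝒜 (K →L[ℂ] K) - Φc.comp (ContinuousLinearMap.fst ℝ 𝒜 (K →L[ℂ] K))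
  have hL : ∀ u v, L (u, v) = v - Φ u := fun u v => rfl
  rw [← hL, he, ← L.integral_comp_comm hi]
  refine setIntegral_congr_fun measurableSet_Ioi fun t ht => ?_
  have hcf : ContinuousOn (F t) (quasispectrum ℝ a ∪ quasispectrum ℝ (Φ a)) :=
    (hF t ht).mono (union_subset (qspec_nonneg a ha) (qspec_nonneg _ hPa))
  have : cfcₙ (F t) (a, Φ a) = (cfcₙ (F t) a, cfcₙ (F t) (Φ a)) := by
    refine cfcₙ_map_prod (S := ℝ) (F t) a (Φ a) hcf (.of_nonneg hX) (.of_nonneg ha) (.of_nonneg hPa)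
  simp only [this, hL]

theorem posmap_real_smul (Φ : 𝒜 →ₗ[ℂ] (K →L[ℂ] K)) (r : ℝ) (x : 𝒜) : Φ (r • x) = r • Φ x :=
  (Φ.restrictScalars ℝ).map_smul r x

theorem map_real_algebraMap (Φ : 𝒜 →ₗ[ℂ] (K →L[ℂ] K)) (h1 : Φ 1 = 1) (r : ℝ) :
    Φ (algebraMap ℝ 𝒜 r) = algebraMap ℝ (K →L[ℂ] K) r := by
  rw [Algebra.algebraMap_eq_smul_one, Algebra.algebraMap_eq_smul_one, posmap_real_smul, h1]

theorem choi_resolvent (Φ : 𝒜 →ₗ[ℂ] (K →L[ℂ] K)) (hΦ : ∀ T, 0 ≤ T → 0 ≤ Φ T) (h1 : Φ 1 = 1)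
    (a : 𝒜) (ha : 0 ≤ a) {t : ℝ} (ht : 0 < t) :
    Ring.inverse (algebraMap ℝ (K →L[ℂ] K) t + Φ a) ≤
      Φ (Ring.inverse (algebraMap ℝ 𝒜 t + a)) := by
  have hs : IsStrictlyPositive (algebraMap ℝ 𝒜 t + a) := by grind
  have := choi_inv Φ hΦ h1 _ hs
  rwa [map_add, map_real_algebraMap Φ h1] at this

theorem jensen01 (Φ : 𝒜 →ₗ[ℂ] (K →L[ℂ] K)) (hΦ : ∀ T, 0 ≤ T → 0 ≤ Φ T) (h1 : Φ 1 = 1)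
    (a : 𝒜) (ha : 0 ≤ a) (s : ℝ≥0) (hs : s ∈ Ioo 0 1) : Φ (a ^ s) ≤ (Φ a) ^ s := by
  obtain ⟨μ, hμ⟩ := exists_measure_nnrpow_eq_integral_cfcₙ_rpowIntegrand₀₁ (𝒜 × (K →L[ℂ] K)) hs
  have hs' : (s : ℝ) ∈ Ioo (0:ℝ) 1 := by exact_mod_cast hs
  have := jensen_core Φ hΦ (rpowIntegrand₀₁ s) s
    (fun t ht => continuousOn_rpowIntegrand₀₁_Ici hs' ht) μ hμ a ha
  rw [← sub_nonneg, this]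
  refine integral_nonneg_of_ae ?_
  filter_upwards [ae_restrict_mem measurableSet_Ioi] with t ht
  have ht : 0 < t := ht
  simp only [Pi.zero_apply]
  rw [cfcn_integrand01 hs' ht a ha, cfcn_integrand01 hs' ht (Φ a) (hΦ a ha), map_sub,
    map_real_algebraMap Φ h1, posmap_real_smul, sub_nonneg]
  exact sub_le_sub_left (smul_le_smul_of_nonneg_left (choi_resolvent Φ hΦ h1 a ha ht)
    (by positivity)) _

theorem jensen12 (Φ : 𝒜 →ₗ[ℂ] (K →L[ℂ] K)) (hΦ : ∀ T, 0 ≤ T → 0 ≤ Φ T) (h1 : Φ 1 = 1)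
    (a : 𝒜) (ha : 0 ≤ a) (s : ℝ≥0) (hs : s ∈ Ioo 1 2) : (Φ a) ^ s ≤ Φ (a ^ s) := by
  obtain ⟨μ, hμ⟩ := exists_measure_nnrpow_eq_integral_cfcₙ_rpowIntegrand₁₂ (𝒜 × (K →L[ℂ] K)) hs
  have hs' : (s : ℝ) ∈ Ioo (1:ℝ) 2 := by exact_mod_cast hs
  have := jensen_core Φ hΦ (rpowIntegrand₁₂ s) s
    (fun t ht => cont_integrand12 ht) μ hμ a ha
  rw [← sub_nonpos, this]
  refine integral_nonpos_of_ae ?_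
  filter_upwards [ae_restrict_mem measurableSet_Ioi] with t ht
  have ht : 0 < t := ht
  simp only [Pi.zero_apply]
  rw [cfcn_integrand12 ht a ha, cfcn_integrand12 ht (Φ a) (hΦ a ha), posmap_real_smul, map_sub, map_add,
    posmap_real_smul, posmap_real_smul, h1, sub_nonpos]
  refine smul_le_smul_of_nonneg_left (sub_le_sub_right (add_le_add_right ?_ _) _) (by positivity)
  exact smul_le_smul_of_nonneg_left (choi_resolvent Φ hΦ h1 a ha ht) ht.le

theorem jensen_rpow01 (Φ : 𝒜 →ₗ[ℂ] (K →L[ℂ] K)) (hΦ : ∀ T, 0 ≤ T → 0 ≤ Φ T) (h1 : Φ 1 = 1)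
    (a : 𝒜) (ha : 0 ≤ a) (s : ℝ) (h0 : 0 < s) (hs : s ≤ 1) : Φ (a ^ s) ≤ (Φ a) ^ s := by
  rcases hs.eq_or_lt with rfl | hs
  · rw [CFC.rpow_one a ha, CFC.rpow_one _ (hΦ a ha)]
  lift s to ℝ≥0 using h0.le
  rw [← CFC.nnrpow_eq_rpow (by exact_mod_cast h0), ← CFC.nnrpow_eq_rpow (by exact_mod_cast h0)]
  exact jensen01 Φ hΦ h1 a ha s ⟨by exact_mod_cast h0, by exact_mod_cast hs⟩

theorem jensen_rpow12 (Φ : 𝒜 →ₗ[ℂ] (K →L[ℂ] K)) (hΦ : ∀ T, 0 ≤ T → 0 ≤ Φ T) (h1 : Φ 1 = 1)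
    (a : 𝒜) (ha : 0 ≤ a) (s : ℝ) (h0 : 1 ≤ s) (hs : s ≤ 2) : (Φ a) ^ s ≤ Φ (a ^ s) := by
  rcases h0.eq_or_lt with rfl | h0
  · rw [CFC.rpow_one a ha, CFC.rpow_one _ (hΦ a ha)]
  rcases hs.eq_or_lt with rfl | hs
  · have e1 := CFC.rpow_natCast a 2 ha
    have e2 := CFC.rpow_natCast (Φ a) 2 (hΦ a ha)
    norm_num at e1 e2
    rw [e1, e2, sq, sq]
    exact kadison_sq Φ hΦ h1 a ha
  have h0' : 0 < s := by linarith
  lift s to ℝ≥0 using h0'.le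
  rw [← CFC.nnrpow_eq_rpow (by exact_mod_cast h0'), ← CFC.nnrpow_eq_rpow (by exact_mod_cast h0')]
  exact jensen12 Φ hΦ h1 a ha s ⟨by exact_mod_cast h0, by exact_mod_cast hs⟩

theorem rpow_antitone {S T : 𝒜} (hS : IsStrictlyPositive S)
    (h : S ≤ T) (r : ℝ) (h0 : -1 ≤ r) (hr : r < 0) : T ^ r ≤ S ^ r := by
  have hT := hS.of_le h
  have h' : S ^ (-r) ≤ T ^ (-r) := CFC.rpow_le_rpow ⟨by linarith, by linarith⟩ h
  have hS' : IsStrictlyPositive (S ^ (-r)) := IsStrictlyPositive.rpow S (-r) hS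
  have hT' : IsStrictlyPositive (T ^ (-r)) := IsStrictlyPositive.rpow T (-r) hT
  have := CStarAlgebra.ringInverse_le_ringInverse h' hS'
  rw [CFC.inverse_eq_rpow_neg_one hS', CFC.inverse_eq_rpow_neg_one hT',
    CFC.rpow_rpow S (-r) (-1) (by linarith) hS,
    CFC.rpow_rpow T (-r) (-1) (by linarith) hT] at this
  simpa using this

theorem rpow_rpow_sp (a : 𝒜) (ha : IsStrictlyPositive a) (x y z : ℝ) (hx : x ≠ 0)
    (h : x * y = z) : (a ^ x) ^ y = a ^ z := by
  rw [CFC.rpow_rpow a x y hx ha, h]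

theorem mean_one_map (Φ : 𝒜 →ₗ[ℂ] (K →L[ℂ] K)) (hΦ : ∀ T, 0 ≤ T → 0 ≤ Φ T) (h1 : Φ 1 = 1)
    (a : 𝒜) (ha : IsStrictlyPositive a) (p q : ℝ) (hpq : StarCond p q) :
    (Φ (a ^ p)) ^ (1 / p) ≤ (Φ (a ^ q)) ^ (1 / q) := by
  have hsp : ∀ r : ℝ, IsStrictlyPositive (a ^ r) := fun r => IsStrictlyPositive.rpow a r ha
  have hM : ∀ r : ℝ, IsStrictlyPositive (Φ (a ^ r)) :=
    fun r => posmap_isStrictlyPositive Φ hΦ h1 _ (hsp r)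
  -- case of exponents at least one
  have caseA : ∀ p q : ℝ, 1 ≤ p → p ≤ q → (Φ (a ^ p)) ^ (1 / p) ≤ (Φ (a ^ q)) ^ (1 / q) := by
    intro p q hp hpq
    have hp0 : 0 < p := by linarith
    have hq0 : 0 < q := by linarith
    have h := jensen_rpow01 Φ hΦ h1 (a ^ q) (hsp q).nonneg (p / q) (by positivity)
      ((div_le_one hq0).2 hpq)
    rw [rpow_rpow_sp a ha q (p / q) p hq0.ne' (by field_simp)] at h
    have h2 : (Φ (a ^ p)) ^ (1 / p) ≤ ((Φ (a ^ q)) ^ (p / q)) ^ (1 / p) :=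
      CFC.rpow_le_rpow ⟨by positivity, (div_le_one hp0).2 hp⟩ h
    rwa [rpow_rpow_sp _ (hM q) (p / q) (1 / p) (1 / q) (by positivity) (by field_simp)] at h2
  -- case of exponents at most minus one
  have caseB : ∀ p q : ℝ, p ≤ q → q ≤ -1 → (Φ (a ^ p)) ^ (1 / p) ≤ (Φ (a ^ q)) ^ (1 / q) := by
    intro p q hpq hq
    have hp0 : p < 0 := by linarith
    have hq0 : q < 0 := by linarith
    have hp' := hp0.ne
    have hq' := hq0.ne
    have h := jensen_rpow01 Φ hΦ h1 (a ^ p) (hsp p).nonneg (q / p) (div_pos_of_neg_of_neg hq0 hp0)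
      (by rw [div_le_one_of_neg hp0]; exact hpq)
    rw [rpow_rpow_sp a ha p (q / p) q hp0.ne (by field_simp)] at h
    have h2 := rpow_antitone (hM q) h (1 / q)
      (by rw [le_div_iff_of_neg hq0]; linarith) (by rw [one_div]; exact inv_lt_zero.2 hq0)
    rwa [rpow_rpow_sp _ (hM p) (q / p) (1 / q) (1 / p) (div_ne_zero hq0.ne hp0.ne)
      (by field_simp)] at h2
  have h11 : a ^ (1:ℝ) = a := CFC.rpow_one a ha.nonneg
  rcases hpq with h | ⟨h, h'⟩ | ⟨h, h'⟩ | ⟨h, h'⟩ | ⟨h, h', h''⟩ | ⟨h, h', h''⟩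
  · rw [h]
  · exact caseA p q h h'.le
  · exact caseB p q h.le h'
  · refine (caseB p (-1) h le_rfl).trans (le_trans ?_ (caseA 1 q le_rfl h'))
    have h3 := choi_inv Φ hΦ h1 (a ^ (-1:ℝ)) (hsp _)
    rw [CFC.inverse_eq_rpow_neg_one (hM _), CFC.inverse_eq_rpow_neg_one (hsp _),
      rpow_rpow_sp a ha (-1) (-1) 1 (by norm_num) (by norm_num)] at h3
    have e : (1:ℝ) / -1 = -1 := by norm_num
    rw [e, div_one, CFC.rpow_one _ (hM 1).nonneg]
    exact h3
  · refine le_trans ?_ (caseA 1 q le_rfl h'')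
    have hp0 : 0 < p := by linarith
    have h3 := jensen_rpow12 Φ hΦ h1 (a ^ p) (hsp p).nonneg (1 / p)
      (by rw [le_div_iff₀ hp0]; linarith) (by rw [div_le_iff₀ hp0]; linarith)
    rw [rpow_rpow_sp a ha p (1 / p) 1 hp0.ne' (by field_simp)] at h3
    rwa [div_one, CFC.rpow_one _ (hM 1).nonneg]
  · refine (caseB p (-1) h le_rfl).trans ?_
    have hq0 : q < 0 := by linarith
    have hq' := hq0.ne
    have h3 := jensen_rpow12 Φ hΦ h1 (a ^ q) (hsp q).nonneg (-1 / q)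
      (by rw [le_div_iff_of_neg hq0]; linarith) (by rw [div_le_iff_of_neg hq0]; linarith)
    rw [rpow_rpow_sp a ha q (-1 / q) (-1) hq0.ne (by field_simp)] at h3
    have h4 := rpow_antitone (IsStrictlyPositive.rpow _ _ (hM q)) h3 (-1) le_rfl (by norm_num)
    rw [rpow_rpow_sp _ (hM q) (-1 / q) (-1) (1 / q) (div_ne_zero (by norm_num) hq0.ne)
      (by field_simp)] at h4
    have e : (1:ℝ) / -1 = -1 := by norm_num
    rwa [e]

theorem starHom_rpow {𝒞 : Type*} [CStarAlgebra 𝒞] [PartialOrder 𝒞] [StarOrderedRing 𝒞]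
    (φh : 𝒞 →⋆ₐ[ℂ] 𝒜) (c : 𝒞) (hc : IsStrictlyPositive c) (r : ℝ) :
    φh (c ^ r) = (φh c) ^ r := by
  have h0 : 0 ∉ spectrum ℝ≥0 c := spectrum.zero_notMem _ hc.isUnit
  have hcont : ContinuousOn (fun x : ℝ≥0 => x ^ r) (spectrum ℝ≥0 c) := fun x hx =>
    (NNReal.continuousAt_rpow_const (.inl (fun h => h0 (h ▸ hx)))).continuousWithinAt
  have hnn : 0 ≤ φh c := map_nonneg φh hc.nonneg
  exact StarAlgHomClass.map_cfc (R := ℝ≥0) (S := ℝ) (φh.restrictScalars ℝ) (fun x : ℝ≥0 => x ^ r)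
    c hcont (map_continuous φh) hc.nonneg hnn

theorem mean_bridge {ℬ : Type*} [CStarAlgebra ℬ] [PartialOrder ℬ] [StarOrderedRing ℬ]
    (Φ₁ : 𝒜 →ₗ[ℂ] (K →L[ℂ] K)) (hΦ₁pos : ∀ T, 0 ≤ T → 0 ≤ Φ₁ T)
    (Φ₂ : ℬ →ₗ[ℂ] (K →L[ℂ] K)) (hΦ₂pos : ∀ T, 0 ≤ T → 0 ≤ Φ₂ T) (hΦ1 : Φ₁ 1 + Φ₂ 1 = 1)
    {𝒞 : Type*} [CStarAlgebra 𝒞] [PartialOrder 𝒞] [StarOrderedRing 𝒞]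
    (π₁ : 𝒞 →⋆ₐ[ℂ] 𝒜) (π₂ : 𝒞 →⋆ₐ[ℂ] ℬ) (c : 𝒞) (hc : IsStrictlyPositive c)
    (p q : ℝ) (hpq : StarCond p q) :
    (Φ₁ ((π₁ c) ^ p) + Φ₂ ((π₂ c) ^ p)) ^ (1 / p) ≤
      (Φ₁ ((π₁ c) ^ q) + Φ₂ ((π₂ c) ^ q)) ^ (1 / q) := by
  let Φ : 𝒞 →ₗ[ℂ] (K →L[ℂ] K) :=
    Φ₁ ∘ₗ π₁.toAlgHom.toLinearMap + Φ₂ ∘ₗ π₂.toAlgHom.toLinearMap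
  have e : ∀ T, Φ T = Φ₁ (π₁ T) + Φ₂ (π₂ T) := fun T => rfl
  have hΦ : ∀ T, 0 ≤ T → 0 ≤ Φ T := fun T hT =>
    add_nonneg (hΦ₁pos _ (map_nonneg π₁ hT)) (hΦ₂pos _ (map_nonneg π₂ hT))
  have h1 : Φ 1 = 1 := by rw [e, map_one π₁, map_one π₂, hΦ1]
  have h := mean_one_map Φ hΦ h1 c hc p q hpq
  rwa [e, e, starHom_rpow π₁ c hc, starHom_rpow π₁ c hc, starHom_rpow π₂ c hc,
    starHom_rpow π₂ c hc] at h

theorem mean_two_maps {ℬ : Type*} [CStarAlgebra ℬ] [PartialOrder ℬ] [StarOrderedRing ℬ]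
    (Φ₁ : 𝒜 →ₗ[ℂ] (K →L[ℂ] K)) (hΦ₁pos : ∀ T, 0 ≤ T → 0 ≤ Φ₁ T)
    (Φ₂ : ℬ →ₗ[ℂ] (K →L[ℂ] K)) (hΦ₂pos : ∀ T, 0 ≤ T → 0 ≤ Φ₂ T) (hΦ1 : Φ₁ 1 + Φ₂ 1 = 1)
    (A : 𝒜) (hA : 0 ≤ A) (hAinv : IsUnit A) (B : ℬ) (hB : 0 ≤ B) (hBinv : IsUnit B)
    (p q : ℝ) (hpq : StarCond p q) :
    (Φ₁ (A ^ p) + Φ₂ (B ^ p)) ^ (1 / p) ≤ (Φ₁ (A ^ q) + Φ₂ (B ^ q)) ^ (1 / q) := by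
  have hu : IsUnit (A, B) := Prod.isUnit_iff.2 ⟨hAinv, hBinv⟩
  have hnn : (0 : 𝒜 × ℬ) ≤ (A, B) := ⟨hA, hB⟩
  exact mean_bridge Φ₁ hΦ₁pos Φ₂ hΦ₂pos hΦ1 (𝒞 := 𝒜 × ℬ) (StarAlgHom.fst ℂ 𝒜 ℬ)
    (StarAlgHom.snd ℂ 𝒜 ℬ) (A, B) (hu.isStrictlyPositive hnn) p q hpq

end J


/-- If `Φᵢ : B(Hᵢ) → B(K)`, `i = 1, 2`, are positive linear maps with
`Φ₁(I) + Φ₂(I) = I`, and `p, q` are nonzero reals satisfying condition (★), then for all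
positive invertible `A ∈ B(H₁)`, `B ∈ B(H₂)`,
`(Φ₁(A^p) + Φ₂(B^p))^(1/p) ≤ (Φ₁(A^q) + Φ₂(B^q))^(1/q)`. -/
theorem powerMean_two_maps_op_inequality
    {H₁ H₂ K : Type*}
    [NormedAddCommGroup H₁] [InnerProductSpace ℂ H₁] [CompleteSpace H₁]
    [NormedAddCommGroup H₂] [InnerProductSpace ℂ H₂] [CompleteSpace H₂]
    [NormedAddCommGroup K] [InnerProductSpace ℂ K] [CompleteSpace K]
    (Φ₁ : (H₁ →L[ℂ] H₁) →ₗ[ℂ] (K →L[ℂ] K))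
    (Φ₂ : (H₂ →L[ℂ] H₂) →ₗ[ℂ] (K →L[ℂ] K))
    (hΦ₁pos : ∀ T : H₁ →L[ℂ] H₁, 0 ≤ T → 0 ≤ Φ₁ T)
    (hΦ₂pos : ∀ T : H₂ →L[ℂ] H₂, 0 ≤ T → 0 ≤ Φ₂ T)
    (hΦ1 : Φ₁ 1 + Φ₂ 1 = 1)
    (p q : ℝ) (hp : p ≠ 0) (hq : q ≠ 0) (hpq : StarCond p q)
    (A : H₁ →L[ℂ] H₁) (hA : 0 ≤ A) (hAinv : IsUnit A)
    (B : H₂ →L[ℂ] H₂) (hB : 0 ≤ B) (hBinv : IsUnit B) :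
    (Φ₁ (A ^ p) + Φ₂ (B ^ p)) ^ (1 / p) ≤ (Φ₁ (A ^ q) + Φ₂ (B ^ q)) ^ (1 / q) := by
  exact mean_two_maps Φ₁ hΦ₁pos Φ₂ hΦ₂pos hΦ1 A hA hAinv B hB hBinv p q hpq
end

section
/- Let p, q be nonzero real numbers, and assume that the matrix power mean inequality ((A^p + B^p)/2)^{1/p} ≤ ((A^q + B^q)/2)^{1/q} holds for every pair of 2×2 positive definite complex matrices A, B. Then (p, q) satisfies condition (★). -/
open scoped ComplexOrder

/-- Real functional calculus for Hermitian complex matrices, via the spectral theorem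
(junk value `0` for non-Hermitian matrices). -/
noncomputable def Matrix.cfcReal {n : Type*} [Fintype n] [DecidableEq n]
    (f : ℝ → ℝ) (A : Matrix n n ℂ) : Matrix n n ℂ :=
  if hA : A.IsHermitian then
    (hA.eigenvectorUnitary : Matrix n n ℂ) *
      Matrix.diagonal (fun i => (f (hA.eigenvalues i) : ℂ)) *
      star (hA.eigenvectorUnitary : Matrix n n ℂ)
  else 0

/-- The real power `A ^ r` of a Hermitian (in particular, positive definite) matrix,
defined by functional calculus, with the conventions `0 ^ r = 0` for `r ≠ 0` and `x ^ 0 = 1`. -/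
noncomputable def Matrix.rpowH {n : Type*} [Fintype n] [DecidableEq n]
    (A : Matrix n n ℂ) (r : ℝ) : Matrix n n ℂ :=
  Matrix.cfcReal (fun t => t ^ r) A

/-- The logarithm of a positive definite matrix, by functional calculus. -/
noncomputable def Matrix.logH {n : Type*} [Fintype n] [DecidableEq n]
    (A : Matrix n n ℂ) : Matrix n n ℂ :=
  Matrix.cfcReal Real.log A

/-- The exponential of a Hermitian matrix, by functional calculus. -/
noncomputable def Matrix.expH {n : Type*} [Fintype n] [DecidableEq n]
    (A : Matrix n n ℂ) : Matrix n n ℂ :=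
  Matrix.cfcReal Real.exp A

open Matrix Filter Topology

lemma cfcReal_two_point {n : Type*} [Fintype n] [DecidableEq n] (f : ℝ → ℝ) (A : Matrix n n ℂ) (hA : A.IsHermitian)
    (a b α β : ℝ) (h : (A - (a : ℂ) • 1) * (A - (b : ℂ) • 1) = 0)
    (ha : f a = α * a + β) (hb : f b = α * b + β) :
    Matrix.cfcReal f A = (α : ℂ) • A + (β : ℂ) • 1 := by
  unfold Matrix.cfcReal
  rw [dif_pos hA]
  have hev : ∀ i, f (hA.eigenvalues i) = α * hA.eigenvalues i + β := by
    intro i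
    have h1 := hA.mulVec_eigenvectorBasis i
    set e : n → ℂ := ⇑(hA.eigenvectorBasis i) with he
    have hne : e ≠ 0 := by
      intro h0
      have := hA.eigenvectorBasis.orthonormal.ne_zero i
      apply this
      ext j
      exact congrFun h0 j
    set l := hA.eigenvalues i
    have hB : ∀ c : ℝ, (A - (c : ℂ) • 1) *ᵥ e = ((l - c : ℝ) : ℂ) • e := by
      intro c
      rw [Matrix.sub_mulVec, h1, Matrix.smul_mulVec, Matrix.one_mulVec]
      ext j
      simp
      ring
    have h2 : ((A - (a : ℂ) • 1) * (A - (b : ℂ) • 1)) *ᵥ e = 0 := by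
      rw [h, Matrix.zero_mulVec]
    rw [← Matrix.mulVec_mulVec, hB, Matrix.mulVec_smul, hB, smul_smul] at h2
    have h3 := (smul_eq_zero.mp h2).resolve_right hne
    have h4 : (l - b) * (l - a) = 0 := by exact_mod_cast h3
    rcases mul_eq_zero.mp h4 with h5 | h5
    · have : l = b := by linarith
      rw [this, hb]
    · have : l = a := by linarith
      rw [this, ha]
  have hd : Matrix.diagonal (fun i => (f (hA.eigenvalues i) : ℂ)) =
      (α : ℂ) • Matrix.diagonal (RCLike.ofReal ∘ hA.eigenvalues) + (β : ℂ) • (1 : Matrix n n ℂ) := by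
    ext i j
    by_cases hij : i = j
    · subst hij
      simp [hev]
    · simp [hij]
  have hs := hA.spectral_theorem
  rw [Unitary.conjStarAlgAut_apply] at hs
  rw [hd, Matrix.mul_add, Matrix.add_mul]
  congr 1
  · conv_rhs => rw [hs]
    simp
  · simp

/-- real symmetric 2 by 2 matrix as complex matrix -/
def sym2 (u w v : ℝ) : Matrix (Fin 2) (Fin 2) ℂ := !![(u : ℂ), (w : ℂ); (w : ℂ), (v : ℂ)]

lemma sym2_herm (u w v : ℝ) : (sym2 u w v).IsHermitian := by
  ext i j
  fin_cases i <;> fin_cases j <;> simp [sym2]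

lemma cfcReal_sym2 (f : ℝ → ℝ) (u w v a b α β : ℝ) (h1 : u + v = a + b)
    (h2 : u * v - w ^ 2 = a * b) (ha : f a = α * a + β) (hb : f b = α * b + β) :
    Matrix.cfcReal f (sym2 u w v) = sym2 (α * u + β) (α * w) (α * v + β) := by
  rw [cfcReal_two_point f _ (sym2_herm u w v) a b α β _ ha hb]
  · ext i j
    fin_cases i <;> fin_cases j <;> simp [sym2]
  · have e1 : (u - a) * (u - b) + w * w = 0 := by
      have : v = a + b - u := by linarith
      subst this
      linarith
    have e2 : (v - a) * (v - b) + w * w = 0 := by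
      have : u = a + b - v := by linarith
      subst this
      linarith
    have e3 : (u - a) * w + w * (v - b) = 0 := by
      linear_combination w * h1
    have e4 : w * (u - b) + (v - a) * w = 0 := by
      linear_combination w * h1
    ext i j
    fin_cases i <;> fin_cases j <;> simp [sym2, Matrix.mul_apply, Fin.sum_univ_two]
    · exact_mod_cast e1
    · exact_mod_cast e3
    · exact_mod_cast e4
    · have e2' : w * w + (v - a) * (v - b) = 0 := by linarith
      exact_mod_cast e2'

lemma sym2_form {u w v : ℝ} (h : (sym2 u w v).PosSemidef) (x y : ℝ) :
    0 ≤ u * x ^ 2 + 2 * w * x * y + v * y ^ 2 := by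
  have := h.dotProduct_mulVec_nonneg ![(x : ℂ), (y : ℂ)]
  simp [sym2, Matrix.mulVec, dotProduct, Fin.sum_univ_two] at this
  have h2 : (0 : ℂ) ≤ ((u * x ^ 2 + 2 * w * x * y + v * y ^ 2 : ℝ) : ℂ) := by
    convert this using 1
    push_cast
    ring
  exact_mod_cast h2

lemma sym2_posDef {u w v : ℝ} (hu : 0 < u) (hd : 0 < u * v - w ^ 2) : (sym2 u w v).PosDef := by
  apply Matrix.PosDef.of_dotProduct_mulVec_pos (sym2_herm u w v)
  intro x hx
  have key : star x ⬝ᵥ (sym2 u w v *ᵥ x) =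
      ((u * Complex.normSq (x 0) + 2 * w * ((x 0).re * (x 1).re + (x 0).im * (x 1).im)
        + v * Complex.normSq (x 1) : ℝ) : ℂ) := by
    simp [sym2, Matrix.mulVec, dotProduct, Fin.sum_univ_two]
    apply Complex.ext
    · simp [Complex.normSq_apply]
      ring
    · simp [Complex.normSq_apply]
      ring
  rw [key]
  have : 0 < (u * Complex.normSq (x 0) + 2 * w * ((x 0).re * (x 1).re + (x 0).im * (x 1).im)
        + v * Complex.normSq (x 1) : ℝ) := by
    simp only [Complex.normSq_apply]
    set a := (x 0).re
    set b := (x 0).im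
    set c := (x 1).re
    set d := (x 1).im
    have hne : 0 < (u * a + w * c) ^ 2 + (u * b + w * d) ^ 2 + (u * v - w ^ 2) * (c ^ 2 + d ^ 2) := by
      by_cases hcd : c = 0 ∧ d = 0
      · obtain ⟨hc, hd'⟩ := hcd
        rw [hc, hd']
        have : ¬ (a = 0 ∧ b = 0) := by
          rintro ⟨h1, h2⟩
          apply hx
          ext i
          fin_cases i
          · exact Complex.ext h1 h2
          · exact Complex.ext hc hd'
        have : 0 < a ^ 2 + b ^ 2 := by
          rcases not_and_or.mp this with h | h <;> positivity
        have := mul_pos (mul_pos hu hu) this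
        nlinarith
      · have : 0 < c ^ 2 + d ^ 2 := by
          rcases not_and_or.mp hcd with h | h <;> positivity
        positivity
    have : 0 < u * (u * (a * a + b * b) + 2 * w * (a * c + b * d) + v * (c * c + d * d)) := by
      nlinarith
    exact pos_of_mul_pos_right this hu.le |> fun h => by simpa using h
  exact_mod_cast this

lemma cfcReal_eq_cfc {n : Type*} [Fintype n] [DecidableEq n] (f : ℝ → ℝ) (A : Matrix n n ℂ)
    (hA : A.IsHermitian) : Matrix.cfcReal f A = cfc f A := by
  rw [hA.cfc_eq, Matrix.IsHermitian.cfc, Unitary.conjStarAlgAut_apply, Matrix.cfcReal, dif_pos hA]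
  rfl

lemma rpowH_posDef {n : Type*} [Fintype n] [DecidableEq n] {A : Matrix n n ℂ}
    (hA : A.PosDef) (r : ℝ) : (Matrix.rpowH A r).PosDef := by
  unfold Matrix.rpowH Matrix.cfcReal
  rw [dif_pos hA.1]
  rw [Matrix.IsUnit.posDef_star_right_conjugate_iff]
  · apply Matrix.PosDef.diagonal
    intro i
    have := Real.rpow_pos_of_pos (hA.eigenvalues_pos i) r
    exact_mod_cast this
  · exact (Unitary.toUnits hA.1.eigenvectorUnitary).isUnit

lemma rpowH_neg {n : Type*} [Fintype n] [DecidableEq n] {A : Matrix n n ℂ}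
    (hA : A.PosDef) (r : ℝ) : Matrix.rpowH A (-r) = (Matrix.rpowH A r)⁻¹ := by
  symm
  apply Matrix.inv_eq_right_inv
  unfold Matrix.rpowH Matrix.cfcReal
  rw [dif_pos hA.1, dif_pos hA.1]
  set U := hA.1.eigenvectorUnitary
  have hU : star (U : Matrix n n ℂ) * (U : Matrix n n ℂ) = 1 := by simp
  have hU' : (U : Matrix n n ℂ) * star (U : Matrix n n ℂ) = 1 := by simp
  have hd : Matrix.diagonal (fun i => (((hA.1.eigenvalues i) ^ r : ℝ) : ℂ)) *
      Matrix.diagonal (fun i => (((hA.1.eigenvalues i) ^ (-r) : ℝ) : ℂ)) = 1 := by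
    rw [Matrix.diagonal_mul_diagonal, ← Matrix.diagonal_one]
    congr 1
    ext i
    rw [← Complex.ofReal_mul, ← Real.rpow_add (hA.eigenvalues_pos i)]
    simp
  calc _ = (U : Matrix n n ℂ) * Matrix.diagonal (fun i => (((hA.1.eigenvalues i) ^ r : ℝ) : ℂ)) *
      (star (U : Matrix n n ℂ) * (U : Matrix n n ℂ)) *
      Matrix.diagonal (fun i => (((hA.1.eigenvalues i) ^ (-r) : ℝ) : ℂ)) *
      star (U : Matrix n n ℂ) := by simp only [Matrix.mul_assoc]
    _ = 1 := by
      rw [hU, Matrix.mul_one, Matrix.mul_assoc (U : Matrix n n ℂ), hd, Matrix.mul_one, hU']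

lemma rpowH_rpowH_neg_one {n : Type*} [Fintype n] [DecidableEq n] {A : Matrix n n ℂ}
    (hA : A.PosDef) (r : ℝ) :
    Matrix.rpowH (Matrix.rpowH A (-1)) r = Matrix.rpowH A (-r) := by
  have h1 := (rpowH_posDef hA (-1)).1
  unfold Matrix.rpowH at *
  rw [cfcReal_eq_cfc _ _ h1, cfcReal_eq_cfc _ _ hA.1, cfcReal_eq_cfc _ _ hA.1]
  have hfin : (spectrum ℝ A).Finite := Matrix.finite_real_spectrum
  refine (cfc_comp (fun t : ℝ => t ^ r) (fun t : ℝ => t ^ (-1 : ℝ)) A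
    (hg := (hfin.image _).continuousOn _) (hf := hfin.continuousOn _) (ha := hA.1)).symm.trans ?_
  apply cfc_congr
  intro x hx
  rw [hA.1.spectrum_real_eq_range_eigenvalues] at hx
  obtain ⟨i, rfl⟩ := hx
  have := hA.eigenvalues_pos i
  simp only [Function.comp]
  rw [← Real.rpow_mul this.le]
  simp

lemma posSemidef_inv_sub {n : Type*} [Fintype n] [DecidableEq n] {X Y : Matrix n n ℂ}
    (hX : X.PosDef) (hY : Y.PosDef) (h : (Y - X).PosSemidef) : (X⁻¹ - Y⁻¹).PosSemidef := by
  have hXi : X⁻¹.PosDef := hX.inv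
  have := hY.isUnit.invertible
  have := hXi.isUnit.invertible
  have h1 := Matrix.PosDef.fromBlocks₂₂ Y (1 : Matrix n n ℂ) hXi
  have h2 := Matrix.PosDef.fromBlocks₁₁ (1 : Matrix n n ℂ) X⁻¹ hY
  have hXX : (X⁻¹)⁻¹ = X := Matrix.nonsing_inv_nonsing_inv X ((Matrix.isUnit_iff_isUnit_det X).mp hX.isUnit)
  rw [hXX] at h1
  simp only [Matrix.conjTranspose_one, Matrix.mul_one, Matrix.one_mul] at h1 h2
  exact h2.mp (h1.mpr h)

/-- The hypothesis -/
def PMI (p q : ℝ) : Prop := ∀ A B : Matrix (Fin 2) (Fin 2) ℂ, A.PosDef → B.PosDef →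
      (Matrix.rpowH ((2 : ℂ)⁻¹ • (Matrix.rpowH A q + Matrix.rpowH B q)) (1 / q) -
        Matrix.rpowH ((2 : ℂ)⁻¹ • (Matrix.rpowH A p + Matrix.rpowH B p)) (1 / p)).PosSemidef

lemma PMI.dual {p q : ℝ} (h : PMI p q) : PMI (-q) (-p) := by
  intro A B hA hB
  have h1 := h _ _ (rpowH_posDef hA (-1)) (rpowH_posDef hB (-1))
  simp only [rpowH_rpowH_neg_one hA, rpowH_rpowH_neg_one hB] at h1
  have hS : ∀ r, ((2 : ℂ)⁻¹ • (Matrix.rpowH A r + Matrix.rpowH B r)).PosDef := by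
    intro r
    exact ((rpowH_posDef hA r).add (rpowH_posDef hB r)).smul (by positivity)
  have h2 := posSemidef_inv_sub (rpowH_posDef (hS _) _) (rpowH_posDef (hS _) _) h1
  rw [← rpowH_neg (hS _), ← rpowH_neg (hS _)] at h2
  simpa only [div_neg] using h2

/-- squared cosine of the direction with slope `x` -/
noncomputable def gg (x : ℝ) : ℝ := 1 / (1 + x ^ 2)

lemma gg_pos (x : ℝ) : 0 < gg x := by unfold gg; positivity

lemma gg_le_one (x : ℝ) : gg x ≤ 1 := by
  unfold gg
  rw [div_le_one (by positivity)]
  nlinarith [sq_nonneg x]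

lemma gg_mul (x : ℝ) : gg x * x ^ 2 = 1 - gg x := by
  unfold gg
  field_simp
  ring

lemma gg_zero : gg 0 = 1 := by simp [gg]

lemma gg_cont : Continuous gg := by
  unfold gg
  apply Continuous.div (by fun_prop) (by fun_prop)
  intro x
  positivity

/-- matrix with eigenvalues `1` (direction `(1,x)`) and `k` -/
noncomputable def Bm (k x : ℝ) : Matrix (Fin 2) (Fin 2) ℂ :=
  sym2 (k + (1 - k) * gg x) ((1 - k) * (gg x * x)) (k + (1 - k) * (1 - gg x))

lemma Bm_det (k g x : ℝ) (hg : g * x ^ 2 = 1 - g) :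
    (k + (1 - k) * g) * (k + (1 - k) * (1 - g)) - ((1 - k) * (g * x)) ^ 2 = k := by
  linear_combination (-(1 - k) ^ 2 * g) * hg

lemma Bm_posDef {k : ℝ} (hk : 0 < k) (x : ℝ) : (Bm k x).PosDef := by
  apply sym2_posDef
  · nlinarith [gg_pos x, gg_le_one x, mul_nonneg hk.le (sub_nonneg.mpr (gg_le_one x))]
  · rw [Bm_det k (gg x) x (gg_mul x)]
    exact hk

lemma Bm_rpow {k : ℝ} (hk1 : k ≠ 1) (x r : ℝ) :
    Matrix.rpowH (Bm k x) r = Bm (k ^ r) x := by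
  have h1 : (1 - k) ≠ 0 := sub_ne_zero.mpr hk1.symm
  have hα : (1 - k ^ r) / (1 - k) * (1 - k) = 1 - k ^ r := by field_simp
  set α := (1 - k ^ r) / (1 - k)
  unfold Matrix.rpowH Bm
  rw [cfcReal_sym2 _ _ _ _ 1 k α (1 - α)]
  · congr 1
    · linear_combination (gg x - 1) * hα
    · linear_combination (gg x * x) * hα
    · linear_combination (- gg x) * hα
  · ring
  · rw [Bm_det k (gg x) x (gg_mul x)]
    ring
  · simp
  · linear_combination hα

lemma bernoulli_line {a s : ℝ} (ha : 0 < a) (hs : s < 0 ∨ 1 ≤ s) : 1 + s * (a - 1) ≤ a ^ s := by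
  rcases hs with hs | hs
  · rw [Real.rpow_def_of_pos ha]
    have h1 := Real.add_one_le_exp (Real.log a * s)
    have h2 := Real.log_le_sub_one_of_pos ha
    nlinarith
  · have := one_add_mul_self_le_rpow_one_add (s := a - 1) (by linarith) hs
    simpa using this

lemma chord_nonneg {c d a b u : ℝ} (ha : 0 ≤ c * a + d) (hb : 0 ≤ c * b + d)
    (hu : (u - a) * (u - b) ≤ 0) : 0 ≤ c * u + d := by
  by_contra hneg
  push Not at hneg
  have h1 : 0 < c * (a - u) := by linarith
  have h2 : 0 < c * (b - u) := by linarith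
  have h3 := mul_pos h1 h2
  nlinarith [mul_nonneg (sq_nonneg c) (neg_nonneg.mpr hu)]

lemma mean_data (r τ κ : ℝ) (hτ : 0 < τ) (hκ : 0 < κ)
    (hs : (0 < r ∧ τ < 1 ∧ κ < 1) ∨ (r < 0 ∧ 1 < τ ∧ 1 < κ)) :
    ∃ m11 m12 m22 : ℝ → ℝ,
      (∀ x, Matrix.rpowH ((2 : ℂ)⁻¹ • (Bm τ 0 + Bm κ x)) (1 / r) = sym2 (m11 x) (m12 x) (m22 x)
        ∧ m11 x ≤ 1 ∧ (r < 1 → 1 - (1 - κ) * (1 - gg x) / (2 * r) ≤ m11 x)) ∧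
      Tendsto (fun x => m12 x / x) (𝓝[≠] 0)
        (𝓝 ((1 - κ) * (1 - ((τ + κ) / 2) ^ (1 / r)) / (2 - τ - κ))) ∧
      Tendsto m22 (𝓝[≠] 0) (𝓝 (((τ + κ) / 2) ^ (1 / r))) := by
  have hr : r ≠ 0 := by rcases hs with h | h <;> [exact h.1.ne'; exact h.1.ne]
  obtain ⟨ε, hε2, hεd⟩ : ∃ ε : ℝ, ε ^ 2 = 1 ∧ 0 < ε * (2 - τ - κ) := by
    rcases hs with h | h
    · exact ⟨1, by norm_num, by linarith⟩
    · exact ⟨-1, by norm_num, by linarith⟩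
  let u : ℝ → ℝ := fun x => (1 + (κ + (1 - κ) * gg x)) / 2
  let v : ℝ → ℝ := fun x => (τ + (κ + (1 - κ) * (1 - gg x))) / 2
  let w : ℝ → ℝ := fun x => (1 - κ) * (gg x * x) / 2
  let s : ℝ → ℝ := fun x => √((u x - v x) ^ 2 + 4 * w x ^ 2)
  let a : ℝ → ℝ := fun x => (u x + v x + ε * s x) / 2
  let b : ℝ → ℝ := fun x => (u x + v x - ε * s x) / 2
  let f : ℝ → ℝ := fun y => y ^ (1 / r)
  let α : ℝ → ℝ := fun x => (f (a x) - f (b x)) / (a x - b x)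
  let β : ℝ → ℝ := fun x => f (a x) - α x * a x
  have hmat : ∀ x, (2 : ℂ)⁻¹ • (Bm τ 0 + Bm κ x) = sym2 (u x) (w x) (v x) := by
    intro x
    ext i j
    fin_cases i <;> fin_cases j <;> simp [sym2, Bm, gg_zero, u, v, w] <;> ring
  have hss : ∀ x, s x ^ 2 = (u x - v x) ^ 2 + 4 * w x ^ 2 := fun x => Real.sq_sqrt (by positivity)
  have hab : ∀ x, u x + v x = a x + b x := by
    intro x
    simp only [a, b]
    ring
  have habm : ∀ x, u x * v x - w x ^ 2 = a x * b x := by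
    intro x
    simp only [a, b]
    linear_combination (1 / 4) * (s x ^ 2) * hε2 + (1 / 4) * hss x
  have hfa : ∀ x, f (a x) = α x * a x + β x := by
    intro x
    simp only [β]
    ring
  have hfb : ∀ x, f (b x) = α x * b x + β x := by
    intro x
    by_cases hh : a x = b x
    · rw [← hh]
      exact hfa x
    · have h1 : a x - b x ≠ 0 := sub_ne_zero.mpr hh
      have h2 : α x * (a x - b x) = f (a x) - f (b x) := by
        simp only [α]
        field_simp
      have key : ∀ A fa fb a b : ℝ, A * (a - b) = fa - fb → fb = A * b + (fa - A * a) := by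
        intro A fa fb a b hh
        linear_combination hh
      exact key _ _ _ _ _ h2
  have hdet : ∀ x, 4 * (u x * v x - w x ^ 2) = τ + (κ * gg x + (1 - gg x)) +
      τ * (κ * (1 - gg x) + gg x) + κ := by
    intro x
    simp only [u, v, w]
    linear_combination (-(1 - κ) ^ 2 * gg x) * gg_mul x
  have htr : ∀ x, 2 * (u x + v x) = 2 + τ + κ := by
    intro x
    simp only [u, v]
    ring
  have hpos : ∀ x, 0 < a x ∧ 0 < b x := by
    intro x
    have hg := gg_pos x
    have hg1 := sub_nonneg.mpr (gg_le_one x)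
    have h1 : 0 < a x * b x := by
      rw [← habm]
      have : 0 < 4 * (u x * v x - w x ^ 2) := by
        rw [hdet]
        positivity
      linarith
    have h2 : 0 < a x + b x := by
      rw [← hab]
      linarith [htr x]
    rcases mul_pos_iff.mp h1 with h | h
    · exact h
    · exfalso
      linarith [h.1, h.2]
  have hone : ∀ x, 0 ≤ (1 - a x) * (1 - b x) := by
    intro x
    have h1 : (1 - a x) * (1 - b x) = (1 - κ) * (1 - τ) * (1 - gg x) / 4 := by
      have := hdet x
      rw [habm] at this
      have h2 := htr x
      rw [hab] at h2
      linear_combination (1 / 4) * this - (1 / 2) * h2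
    rw [h1]
    have hg1 := sub_nonneg.mpr (gg_le_one x)
    have : 0 ≤ (1 - κ) * (1 - τ) := by
      rcases hs with h | h <;> nlinarith [h.1, h.2.1, h.2.2]
    positivity
  have hle : ∀ x, f (a x) ≤ 1 ∧ f (b x) ≤ 1 := by
    intro x
    have hp := hpos x
    have ho := hone x
    have h2 := htr x
    rw [hab] at h2
    rcases hs with h | h
    · have ha : a x ≤ 1 := by
        by_contra hc
        push Not at hc
        nlinarith [h.2.1, h.2.2]
      have hb : b x ≤ 1 := by
        by_contra hc
        push Not at hc
        nlinarith [h.2.1, h.2.2]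
      have hr' : 0 ≤ 1 / r := by have := h.1; positivity
      exact ⟨Real.rpow_le_one hp.1.le ha hr', Real.rpow_le_one hp.2.le hb hr'⟩
    · have ha : 1 ≤ a x := by
        by_contra hc
        push Not at hc
        nlinarith [h.2.1, h.2.2]
      have hb : 1 ≤ b x := by
        by_contra hc
        push Not at hc
        nlinarith [h.2.1, h.2.2]
      have hr' : 1 / r ≤ 0 := (one_div_neg.mpr h.1).le
      exact ⟨Real.rpow_le_one_of_one_le_of_nonpos ha hr',
        Real.rpow_le_one_of_one_le_of_nonpos hb hr'⟩
  have hbet : ∀ x, (u x - a x) * (u x - b x) ≤ 0 := by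
    intro x
    have : (u x - a x) * (u x - b x) = - w x ^ 2 := by
      linear_combination (u x) * hab x - habm x
    rw [this]
    nlinarith [sq_nonneg (w x)]
  -- values at zero
  have hu0 : u 0 = 1 := by simp [u, gg_zero]
  have hv0 : v 0 = (τ + κ) / 2 := by simp [v, gg_zero]
  have hw0 : w 0 = 0 := by simp [w]
  have hs0 : ε * s 0 = 1 - (τ + κ) / 2 := by
    have h1 : s 0 = |1 - (τ + κ) / 2| := by
      simp only [s, hu0, hv0, hw0]
      rw [← Real.sqrt_sq_eq_abs]
      congr 1
      ring
    have h2 : s 0 = ε * (1 - (τ + κ) / 2) := by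
      have hpos' : 0 < ε * (1 - (τ + κ) / 2) := by linarith
      have hε : |ε| = 1 := by
        have : |ε| ^ 2 = 1 := by rw [sq_abs, hε2]
        nlinarith [abs_nonneg ε]
      rw [h1, ← abs_of_pos hpos', abs_mul, hε, one_mul]
    rw [h2]
    linear_combination (1 - (τ + κ) / 2) * hε2
  have ha0 : a 0 = 1 := by
    simp only [a]
    rw [hs0, hu0, hv0]
    ring
  have hb0 : b 0 = (τ + κ) / 2 := by
    simp only [b]
    rw [hs0, hu0, hv0]
    ring
  have hgc := gg_cont
  have huc : Continuous u := by simp only [u]; fun_prop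
  have hvc : Continuous v := by simp only [v]; fun_prop
  have hwc : Continuous w := by simp only [w]; fun_prop
  have hsc : Continuous s := by simp only [s]; fun_prop
  have hac : Continuous a := by simp only [a]; fun_prop
  have hbc : Continuous b := by simp only [b]; fun_prop
  have hfac : Continuous (fun x => f (a x)) := by
    simp only [f]
    exact hac.rpow_const (fun x => Or.inl (hpos x).1.ne')
  have hfbc : Continuous (fun x => f (b x)) := by
    simp only [f]
    exact hbc.rpow_const (fun x => Or.inl (hpos x).2.ne')
  have hd0 : (2 - τ - κ) ≠ 0 := by
    intro h0
    rw [h0] at hεd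
    simp at hεd
  have hαc : ContinuousAt α 0 := by
    apply ContinuousAt.div (hfac.continuousAt.sub hfbc.continuousAt)
      (hac.continuousAt.sub hbc.continuousAt)
    rw [Pi.sub_apply, ha0, hb0]
    intro h0
    apply hd0
    linarith
  have hβc : ContinuousAt β 0 := hfac.continuousAt.sub (hαc.mul hac.continuousAt)
  refine ⟨fun x => α x * u x + β x, fun x => α x * w x, fun x => α x * v x + β x, ?_, ?_, ?_⟩
  · intro x
    refine ⟨?_, ?_, ?_⟩
    · rw [hmat]
      exact cfcReal_sym2 f _ _ _ (a x) (b x) (α x) (β x) (hab x) (habm x) (hfa x) (hfb x)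
    · have := chord_nonneg (c := - α x) (d := 1 - β x) (a := a x) (b := b x) (u := u x)
        (by linarith [(hle x).1, hfa x]) (by linarith [(hle x).2, hfb x]) (hbet x)
      simp only
      linarith
    · intro hr1
      have hs' : 1 / r < 0 ∨ 1 ≤ 1 / r := by
        rcases lt_or_gt_of_ne hr with h | h
        · exact Or.inl (one_div_neg.mpr h)
        · right
          rw [le_div_iff₀ h]
          linarith
      have h1 := bernoulli_line (hpos x).1 hs'
      have h2 := bernoulli_line (hpos x).2 hs'
      have h1' := hfa x
      have h2' := hfb x
      simp only [f] at h1' h2'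
      have := chord_nonneg (c := α x - 1 / r) (d := β x - 1 + 1 / r) (a := a x) (b := b x)
        (u := u x) (by linarith) (by linarith) (hbet x)
      have hu : u x = 1 - (1 - κ) * (1 - gg x) / 2 := by
        simp only [u]
        ring
      have h3 : (1 - κ) * (1 - gg x) / (2 * r) = 1 / r * (1 - u x) := by
        rw [hu]
        field_simp
        ring
      rw [h3]
      simp only
      linarith
  · have h1 : Tendsto (fun x => α x * ((1 - κ) * gg x / 2)) (𝓝[≠] 0)
        (𝓝 (α 0 * ((1 - κ) * gg 0 / 2))) := by
      apply Tendsto.mono_left _ nhdsWithin_le_nhds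
      apply ContinuousAt.tendsto
      apply hαc.mul
      fun_prop
    have h2 : α 0 * ((1 - κ) * gg 0 / 2) =
        (1 - κ) * (1 - ((τ + κ) / 2) ^ (1 / r)) / (2 - τ - κ) := by
      simp only [α, f, ha0, hb0, gg_zero, Real.one_rpow]
      have : 1 - (τ + κ) / 2 = (2 - τ - κ) / 2 := by ring
      rw [this]
      field_simp
    rw [h2] at h1
    refine h1.congr' ?_
    filter_upwards [self_mem_nhdsWithin] with x hx
    have hx' : x ≠ 0 := hx
    simp only [w]
    field_simp
  · have h1 : ContinuousAt (fun x => α x * v x + β x) 0 :=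
      (hαc.mul hvc.continuousAt).add hβc
    have h2 : α 0 * v 0 + β 0 = ((τ + κ) / 2) ^ (1 / r) := by
      rw [hv0, ← hb0, ← hfb]
    have h3 := h1.tendsto
    rw [h2] at h3
    exact h3.mono_left nhdsWithin_le_nhds

lemma rpow_side {t r : ℝ} (ht : 0 < t) (ht1 : t < 1 / 2) (hr : r ≠ 0) :
    (0 < r ∧ t ^ r < 1 ∧ (2 * t) ^ r < 1) ∨ (r < 0 ∧ 1 < t ^ r ∧ 1 < (2 * t) ^ r) := by
  rcases lt_or_gt_of_ne hr with h | h
  · right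
    exact ⟨h, Real.one_lt_rpow_of_pos_of_lt_one_of_neg ht (by linarith) h,
      Real.one_lt_rpow_of_pos_of_lt_one_of_neg (by linarith) (by linarith) h⟩
  · left
    exact ⟨h, Real.rpow_lt_one ht.le (by linarith) h,
      Real.rpow_lt_one (by linarith) (by linarith) h⟩

/-- scalar mean -/
noncomputable def mm (r t : ℝ) : ℝ := ((t ^ r + (2 * t) ^ r) / 2) ^ (1 / r)

/-- off-diagonal derivative -/
noncomputable def NN (r t : ℝ) : ℝ := (1 - (2 * t) ^ r) * (1 - mm r t) / (2 - t ^ r - (2 * t) ^ r)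

lemma key_ineq {p q t : ℝ} (hp : p ≠ 0) (hq : q ≠ 0) (hp1 : p < 1) (h : PMI p q)
    (ht : 0 < t) (ht1 : t < 1 / 2) :
    (NN q t - NN p t) ^ 2 ≤ (1 - (2 * t) ^ p) / (2 * p) * (mm q t - mm p t) := by
  obtain ⟨a11, a12, a22, ha, ha12, ha22⟩ := mean_data p (t ^ p) ((2 * t) ^ p) (by positivity)
    (by positivity) (rpow_side ht ht1 hp)
  obtain ⟨b11, b12, b22, hb, hb12, hb22⟩ := mean_data q (t ^ q) ((2 * t) ^ q) (by positivity)
    (by positivity) (rpow_side ht ht1 hq)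
  change Tendsto _ _ (𝓝 (NN p t)) at ha12
  change Tendsto _ _ (𝓝 (NN q t)) at hb12
  change Tendsto _ _ (𝓝 (mm p t)) at ha22
  change Tendsto _ _ (𝓝 (mm q t)) at hb22
  set C := (1 - (2 * t) ^ p) / (2 * p) with hC
  have hform : ∀ y : ℝ, 0 ≤ C * (y * y) + (2 * (NN q t - NN p t)) * y + (mm q t - mm p t) := by
    intro y
    have hlim : Tendsto (fun x => C * gg x * (y * y) + (2 * (b12 x / x - a12 x / x)) * y +
        (b22 x - a22 x)) (𝓝[≠] 0)
        (𝓝 (C * 1 * (y * y) + (2 * (NN q t - NN p t)) * y + (mm q t - mm p t))) := by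
      have hg : Tendsto gg (𝓝[≠] 0) (𝓝 1) := by
        have := gg_cont.tendsto 0
        rw [gg_zero] at this
        exact this.mono_left nhdsWithin_le_nhds
      exact (((hg.const_mul C).mul_const _).add (((hb12.sub ha12).const_mul 2).mul_const y)).add
        (hb22.sub ha22)
    rw [mul_one] at hlim
    refine ge_of_tendsto hlim ?_
    filter_upwards [self_mem_nhdsWithin] with x hx
    have hx' : x ≠ 0 := hx
    have hh := h _ _ (Bm_posDef ht 0) (Bm_posDef (k := 2 * t) (by positivity) x)
    simp only [Bm_rpow (k := t) (by linarith), Bm_rpow (k := 2 * t) (by linarith)] at hh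
    rw [(ha x).1, (hb x).1] at hh
    have hsub : sym2 (b11 x) (b12 x) (b22 x) - sym2 (a11 x) (a12 x) (a22 x) =
        sym2 (b11 x - a11 x) (b12 x - a12 x) (b22 x - a22 x) := by
      ext i j
      fin_cases i <;> fin_cases j <;> simp [sym2]
    rw [hsub] at hh
    have hq1 := sym2_form hh (y / x) 1
    have h1 : b11 x - a11 x ≤ C * (gg x * x ^ 2) := by
      have h2 := (ha x).2.2 hp1
      have h3 := (hb x).2.1
      rw [gg_mul]
      have : C * (1 - gg x) = (1 - (2 * t) ^ p) * (1 - gg x) / (2 * p) := by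
        rw [hC]
        ring
      rw [this]
      linarith
    have h2 := mul_le_mul_of_nonneg_right h1 (sq_nonneg (y / x))
    have h3 : C * (gg x * x ^ 2) * (y / x) ^ 2 = C * gg x * (y * y) := by
      field_simp
    have h4 : 2 * (b12 x - a12 x) * (y / x) * 1 = 2 * (b12 x / x - a12 x / x) * y := by
      field_simp
    rw [h4] at hq1
    rw [h3] at h2
    linarith
  have := discrim_le_zero hform
  unfold discrim at this
  linarith

/-- scalar constant -/
noncomputable def CC (r : ℝ) : ℝ := ((1 + 2 ^ r) / 2) ^ (1 / r)

lemma mm_eq {r t : ℝ} (hr : r ≠ 0) (ht : 0 < t) : mm r t = CC r * t := by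
  unfold mm CC
  rw [Real.mul_rpow (by norm_num) ht.le]
  have : (t ^ r + 2 ^ r * t ^ r) / 2 = (1 + 2 ^ r) / 2 * t ^ r := by ring
  rw [this, Real.mul_rpow (by positivity) (by positivity), ← Real.rpow_mul ht.le,
    mul_one_div_cancel hr, Real.rpow_one]

lemma tendsto_rpow_zero {s : ℝ} (hs : 0 < s) :
    Tendsto (fun t : ℝ => t ^ s) (𝓝[>] 0) (𝓝 0) := by
  have := (Real.continuousAt_rpow_const 0 s (Or.inr hs.le)).tendsto
  rw [Real.zero_rpow hs.ne'] at this
  exact this.mono_left nhdsWithin_le_nhds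

lemma tendsto_id_zero : Tendsto (fun t : ℝ => t) (𝓝[>] 0) (𝓝 0) :=
  tendsto_id.mono_left nhdsWithin_le_nhds

lemma ev_small : ∀ᶠ t : ℝ in 𝓝[>] 0, 0 < t ∧ t < 1 / 2 := by
  have : Set.Ioo (0 : ℝ) (1 / 2) ∈ 𝓝[>] (0 : ℝ) := Ioo_mem_nhdsGT (by norm_num)
  exact this

lemma NN_tendsto_pos {r : ℝ} (hr : 0 < r) : Tendsto (NN r) (𝓝[>] 0) (𝓝 (1 / 2)) := by
  have h1 := tendsto_rpow_zero hr
  have h2 : Tendsto (fun t : ℝ => (1 - 2 ^ r * t ^ r) * (1 - CC r * t) /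
      (2 - t ^ r - 2 ^ r * t ^ r)) (𝓝[>] 0)
      (𝓝 ((1 - 2 ^ r * 0) * (1 - CC r * 0) / (2 - 0 - 2 ^ r * 0))) :=
    ((tendsto_const_nhds.sub (h1.const_mul _)).mul
      (tendsto_const_nhds.sub (tendsto_id_zero.const_mul _))).div
      ((tendsto_const_nhds.sub h1).sub (h1.const_mul _)) (by norm_num)
  have h3 : ((1 - (2 : ℝ) ^ r * 0) * (1 - CC r * 0) / (2 - 0 - 2 ^ r * 0)) = 1 / 2 := by norm_num
  rw [h3] at h2
  refine h2.congr' ?_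
  filter_upwards [ev_small] with t ht
  unfold NN
  rw [mm_eq hr.ne' ht.1, Real.mul_rpow (by norm_num) ht.1.le]

lemma NN_tendsto_neg {r : ℝ} (hr : r < 0) :
    Tendsto (NN r) (𝓝[>] 0) (𝓝 (2 ^ r / (1 + 2 ^ r))) := by
  have h1 := tendsto_rpow_zero (s := -r) (by linarith)
  have hpos : (0 : ℝ) < 2 ^ r := by positivity
  have h2 : Tendsto (fun t : ℝ => (t ^ (-r) - 2 ^ r) * (1 - CC r * t) /
      (2 * t ^ (-r) - 1 - 2 ^ r)) (𝓝[>] 0)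
      (𝓝 ((0 - 2 ^ r) * (1 - CC r * 0) / (2 * 0 - 1 - 2 ^ r))) :=
    ((h1.sub tendsto_const_nhds).mul
      (tendsto_const_nhds.sub (tendsto_id_zero.const_mul _))).div
      (((h1.const_mul _).sub tendsto_const_nhds).sub tendsto_const_nhds) (by linarith)
  have h3 : ((0 - (2 : ℝ) ^ r) * (1 - CC r * 0) / (2 * 0 - 1 - 2 ^ r)) = 2 ^ r / (1 + 2 ^ r) := by
    rw [div_eq_div_iff (by linarith) (by linarith)]
    ring
  rw [h3] at h2
  refine h2.congr' ?_
  filter_upwards [ev_small] with t ht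
  unfold NN
  rw [mm_eq hr.ne ht.1, Real.mul_rpow (by norm_num) ht.1.le]
  have ht' : (0 : ℝ) < t ^ (-r) := Real.rpow_pos_of_pos ht.1 _
  have hm : t ^ r * t ^ (-r) = 1 := by rw [← Real.rpow_add ht.1]; simp
  rw [← mul_div_mul_right _ (2 - t ^ r - 2 ^ r * t ^ r) ht'.ne']
  congr 1
  · linear_combination (2 ^ r * (1 - CC r * t)) * hm
  · linear_combination (1 + 2 ^ r) * hm

lemma NN_scaled {r p : ℝ} (hr : 0 < r) (hp1 : p < 1) {l : ℝ}
    (hl : Tendsto (fun t : ℝ => t ^ (r - p)) (𝓝[>] 0) (𝓝 l)) :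
    Tendsto (fun t => (NN r t - 1 / 2) / t ^ p) (𝓝[>] 0) (𝓝 (l * (1 - 2 ^ r) / 4)) := by
  have h1 := tendsto_rpow_zero hr
  have h4 := tendsto_rpow_zero (s := 1 - p) (by linarith)
  have h2 : Tendsto (fun t : ℝ => (t ^ (r - p) * (1 - 2 ^ r) / 2
      - (1 - 2 ^ r * t ^ r) * CC r * t ^ (1 - p)) / (2 - t ^ r - 2 ^ r * t ^ r)) (𝓝[>] 0)
      (𝓝 ((l * (1 - 2 ^ r) / 2 - (1 - 2 ^ r * 0) * CC r * 0) / (2 - 0 - 2 ^ r * 0))) :=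
    (((hl.mul_const _).div_const _).sub
      (((tendsto_const_nhds.sub (h1.const_mul _)).mul_const _).mul h4)).div
      ((tendsto_const_nhds.sub h1).sub (h1.const_mul _)) (by norm_num)
  have h3 : ((l * (1 - (2 : ℝ) ^ r) / 2 - (1 - 2 ^ r * 0) * CC r * 0) / (2 - 0 - 2 ^ r * 0))
      = l * (1 - 2 ^ r) / 4 := by
    norm_num
    ring
  rw [h3] at h2
  refine h2.congr' ?_
  filter_upwards [ev_small] with t ht
  have hside := rpow_side ht.1 ht.2 hr.ne'
  unfold NN
  rw [mm_eq hr.ne' ht.1]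
  rw [Real.mul_rpow (by norm_num) ht.1.le] at hside ⊢
  have hpp : (0 : ℝ) < t ^ p := Real.rpow_pos_of_pos ht.1 _
  rw [Real.rpow_sub ht.1, Real.rpow_sub ht.1, Real.rpow_one]
  have hd : 2 - t ^ r - 2 ^ r * t ^ r ≠ 0 := by
    rcases hside with h | h <;> [skip; skip]
    · have := h.2.1
      have := h.2.2
      intro h0
      linarith
    · linarith [h.1]
  generalize (2 : ℝ) ^ r = P at *
  generalize t ^ r = R at *
  generalize t ^ p = Q at *
  have hd' : 2 - R * (1 + P) ≠ 0 := by
    intro h0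
    apply hd
    linarith
  have hD : 2 - R - P * R = 2 - R * (1 + P) := by ring
  rw [hD]
  field_simp
  ring

lemma not_PMI {p q : ℝ} (hp : p ≠ 0) (hq : q ≠ 0) (hpq : p < q) (hp1 : -1 < p) (hp2 : p < 1 / 2)
    (h : PMI p q) : False := by
  have hkey : ∀ᶠ t : ℝ in 𝓝[>] 0, (NN q t - NN p t) ^ 2 ≤
      (1 - 2 ^ p * t ^ p) / (2 * p) * ((CC q - CC p) * t) := by
    filter_upwards [ev_small] with t ht
    have := key_ineq hp hq (by linarith) h ht.1 ht.2
    rw [mm_eq hp ht.1, mm_eq hq ht.1, Real.mul_rpow (by norm_num) ht.1.le] at this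
    convert this using 2
    ring
  rcases lt_or_gt_of_ne hp with hneg | hpos
  · have hR : Tendsto (fun t : ℝ => (t - 2 ^ p * t ^ (1 + p)) / (2 * p) * (CC q - CC p)) (𝓝[>] 0)
        (𝓝 ((0 - 2 ^ p * 0) / (2 * p) * (CC q - CC p))) :=
      ((tendsto_id_zero.sub ((tendsto_rpow_zero (by linarith)).const_mul _)).div_const _).mul_const _
    have hR2 : Tendsto (fun t : ℝ => (1 - 2 ^ p * t ^ p) / (2 * p) * ((CC q - CC p) * t)) (𝓝[>] 0)
        (𝓝 0) := by
      have h3 : ((0 - (2 : ℝ) ^ p * 0) / (2 * p) * (CC q - CC p)) = 0 := by simp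
      rw [h3] at hR
      refine hR.congr' ?_
      filter_upwards [ev_small] with t ht
      rw [Real.rpow_add ht.1, Real.rpow_one]
      ring
    have hNp := NN_tendsto_neg hneg
    have h2p : (0 : ℝ) < 2 ^ p := by positivity
    obtain ⟨l, hl, hNq⟩ : ∃ l : ℝ, 2 ^ p / (1 + 2 ^ p) < l ∧ Tendsto (NN q) (𝓝[>] 0) (𝓝 l) := by
      rcases lt_or_gt_of_ne hq with hq' | hq'
      · refine ⟨_, ?_, NN_tendsto_neg hq'⟩
        have : (2 : ℝ) ^ p < 2 ^ q := Real.rpow_lt_rpow_of_exponent_lt (by norm_num) hpq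
        rw [div_lt_div_iff₀ (by linarith) (by linarith)]
        nlinarith
      · refine ⟨_, ?_, NN_tendsto_pos hq'⟩
        have : (2 : ℝ) ^ p < 1 := Real.rpow_lt_one_of_one_lt_of_neg (by norm_num) hneg
        rw [div_lt_div_iff₀ (by linarith) (by linarith)]
        linarith
    have hfin := le_of_tendsto_of_tendsto ((hNq.sub hNp).pow 2) hR2 hkey
    have : 0 < (l - 2 ^ p / (1 + 2 ^ p)) ^ 2 := by
      have := sub_pos.mpr hl
      positivity
    linarith
  · have hq' : 0 < q := by linarith
    have hNp := NN_scaled (r := p) (p := p) (l := 1) hpos (by linarith) (by simp)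
    have hNq := NN_scaled (r := q) (p := p) (l := 0) hq' (by linarith)
      (tendsto_rpow_zero (by linarith))
    have hR : Tendsto (fun t : ℝ => (1 - 2 ^ p * t ^ p) / (2 * p) * ((CC q - CC p) * t ^ (1 - 2 * p)))
        (𝓝[>] 0) (𝓝 ((1 - 2 ^ p * 0) / (2 * p) * ((CC q - CC p) * 0))) :=
      ((tendsto_const_nhds.sub ((tendsto_rpow_zero hpos).const_mul _)).div_const _).mul
        ((tendsto_rpow_zero (by linarith)).const_mul _)
    have hfin := le_of_tendsto_of_tendsto ((hNq.sub hNp).pow 2) hR (by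
      filter_upwards [ev_small, hkey] with t ht hk
      have hpp : (0 : ℝ) < t ^ p := Real.rpow_pos_of_pos ht.1 _
      have e1 : ((NN q t - 1 / 2) / t ^ p - (NN p t - 1 / 2) / t ^ p) ^ 2 =
          (NN q t - NN p t) ^ 2 / (t ^ p) ^ 2 := by
        rw [← sub_div, div_pow]
        congr 2
        ring
      have e2 : t ^ (1 - 2 * p) = t / (t ^ p) ^ 2 := by
        rw [Real.rpow_sub ht.1, Real.rpow_one, two_mul, Real.rpow_add ht.1, sq]
      rw [e1, e2, div_le_iff₀ (by positivity)]
      refine hk.trans (le_of_eq ?_)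
      field_simp)
    have h2p : (1 : ℝ) < 2 ^ p := Real.one_lt_rpow (by norm_num) hpos
    have : 0 < (0 * (1 - (2 : ℝ) ^ q) / 4 - 1 * (1 - 2 ^ p) / 4) ^ 2 := by
      have : 0 < (0 * (1 - (2 : ℝ) ^ q) / 4 - 1 * (1 - 2 ^ p) / 4) := by linarith
      positivity
    simp only [mul_zero] at hfin
    linarith

lemma scalar_rpow (c r : ℝ) : Matrix.rpowH (sym2 c 0 c) r = sym2 (c ^ r) 0 (c ^ r) := by
  unfold Matrix.rpowH
  rw [cfcReal_sym2 _ c 0 c c c 0 (c ^ r) (by ring) (by ring) (by simp) (by simp)]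
  simp

lemma PMI.scalar {p q : ℝ} (h : PMI p q) : CC p ≤ CC q := by
  have h1 := h (sym2 1 0 1) (sym2 2 0 2) (sym2_posDef (by norm_num) (by norm_num))
    (sym2_posDef (by norm_num) (by norm_num))
  have hadd : ∀ r : ℝ, (2 : ℂ)⁻¹ • (sym2 1 0 1 + sym2 (2 ^ r) 0 (2 ^ r)) =
      sym2 ((1 + 2 ^ r) / 2) 0 ((1 + 2 ^ r) / 2) := by
    intro r
    ext i j
    fin_cases i <;> fin_cases j <;> simp [sym2] <;> ring
  simp only [scalar_rpow, Real.one_rpow, hadd] at h1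
  have hsub : ∀ a b : ℝ, sym2 a 0 a - sym2 b 0 b = sym2 (a - b) 0 (a - b) := by
    intro a b
    ext i j
    fin_cases i <;> fin_cases j <;> simp [sym2]
  rw [hsub] at h1
  have := sym2_form h1 1 0
  unfold CC
  linarith

lemma CC_lt_of_pos {q p : ℝ} (hq : 0 < q) (hqp : q < p) : CC q < CC p := by
  have hp : 0 < p := hq.trans hqp
  have h2q : (1 : ℝ) < 2 ^ q := Real.one_lt_rpow (by norm_num) hq
  have hsc : StrictConvexOn ℝ (Set.Ici 0) fun x : ℝ => x ^ (p / q) :=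
    strictConvexOn_rpow (by rw [lt_div_iff₀ hq]; linarith)
  have hm1 : (1 : ℝ) ∈ Set.Ici (0 : ℝ) := by simp
  have hm2 : (2 : ℝ) ^ q ∈ Set.Ici (0 : ℝ) := Set.mem_Ici.mpr (by linarith)
  have hhalf : (0 : ℝ) < 1 / 2 := by norm_num
  have hsum : (1 / 2 : ℝ) + 1 / 2 = 1 := by norm_num
  have h1 := hsc.2 hm1 hm2 h2q.ne hhalf hhalf hsum
  simp only [smul_eq_mul, Real.one_rpow] at h1
  rw [← Real.rpow_mul (by norm_num : (0 : ℝ) ≤ 2), mul_div_cancel₀ _ hq.ne'] at h1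
  have h2 : ((1 + (2 : ℝ) ^ q) / 2) ^ (p / q) < (1 + 2 ^ p) / 2 := by
    have e : ∀ z : ℝ, 1 / 2 * 1 + 1 / 2 * z = (1 + z) / 2 := by
      intro z
      ring
    rw [e, e] at h1
    exact h1
  have h3 := Real.rpow_lt_rpow (by positivity) h2 (z := 1 / p) (by positivity)
  rw [← Real.rpow_mul (by positivity)] at h3
  have : p / q * (1 / p) = 1 / q := by field_simp
  rw [this] at h3
  exact h3

lemma amgm_two {r : ℝ} (hr : r ≠ 0) : (2 : ℝ) ^ (r / 2) < (1 + 2 ^ r) / 2 := by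
  have h1 : (2 : ℝ) ^ r = (2 ^ (r / 2)) ^ 2 := by
    rw [← Real.rpow_natCast, ← Real.rpow_mul (by norm_num)]
    congr 1
    push_cast
    ring
  have h2 : (2 : ℝ) ^ (r / 2) ≠ 1 := by
    rcases lt_or_gt_of_ne hr with h | h
    · exact (Real.rpow_lt_one_of_one_lt_of_neg (by norm_num) (by linarith)).ne
    · exact (Real.one_lt_rpow (by norm_num) (by linarith)).ne'
  rw [h1]
  have := sub_ne_zero.mpr h2
  have : 0 < ((2 : ℝ) ^ (r / 2) - 1) ^ 2 := by positivity
  linarith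

lemma CC_pos_gt {r : ℝ} (hr : 0 < r) : (2 : ℝ) ^ (1 / 2 : ℝ) < CC r := by
  have h3 := Real.rpow_lt_rpow (by positivity) (amgm_two hr.ne') (z := 1 / r) (by positivity)
  rw [← Real.rpow_mul (by positivity)] at h3
  have : r / 2 * (1 / r) = 1 / 2 := by field_simp
  rw [this] at h3
  exact h3

lemma CC_neg_lt {r : ℝ} (hr : r < 0) : CC r < (2 : ℝ) ^ (1 / 2 : ℝ) := by
  have h3 := Real.rpow_lt_rpow_of_neg (by positivity) (amgm_two hr.ne) (one_div_neg.mpr hr)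
  rw [← Real.rpow_mul (by positivity)] at h3
  have : r / 2 * (1 / r) = 1 / 2 := by
    have := hr.ne
    field_simp
  rw [this] at h3
  exact h3

lemma PMI.le {p q : ℝ} (hp : p ≠ 0) (hq : q ≠ 0) (h : PMI p q) : p ≤ q := by
  by_contra hlt
  push Not at hlt
  rcases lt_or_gt_of_ne hq with hq' | hq'
  · rcases lt_or_gt_of_ne hp with hp' | hp'
    · have h1 := h.dual.scalar
      have h2 := CC_lt_of_pos (q := -p) (p := -q) (by linarith) (by linarith)
      linarith
    · linarith [CC_pos_gt hp', CC_neg_lt hq', h.scalar]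
  · linarith [CC_lt_of_pos hq' hlt, h.scalar]

/-- If `p, q` are nonzero reals such that the power mean inequality
`((A^p + B^p)/2)^(1/p) ≤ ((A^q + B^q)/2)^(1/q)` holds for every pair of `2 × 2` positive
definite complex matrices `A, B`, then `(p, q)` satisfies condition (★). -/
theorem starCond_of_powerMean_matrix_inequality (p q : ℝ) (hp : p ≠ 0) (hq : q ≠ 0)
    (h : ∀ A B : Matrix (Fin 2) (Fin 2) ℂ, A.PosDef → B.PosDef →
      (Matrix.rpowH ((2 : ℂ)⁻¹ • (Matrix.rpowH A q + Matrix.rpowH B q)) (1 / q) -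
        Matrix.rpowH ((2 : ℂ)⁻¹ • (Matrix.rpowH A p + Matrix.rpowH B p)) (1 / p)).PosSemidef) :
    StarCond p q := by
  have h' : PMI p q := h
  have hle := h'.le hp hq
  rcases hle.eq_or_lt with heq | hlt
  · exact Or.inl heq
  · right
    have h1 : p ≤ -1 ∨ 1 / 2 ≤ p := by
      by_contra hc
      push Not at hc
      exact not_PMI hp hq hlt hc.1 hc.2 h'
    have h2 : -q ≤ -1 ∨ 1 / 2 ≤ -q := by
      by_contra hc
      push Not at hc
      exact not_PMI (neg_ne_zero.mpr hq) (neg_ne_zero.mpr hp) (by linarith) hc.1 hc.2 h'.dual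
    rcases h1 with h1 | h1
    · rcases h2 with h2 | h2
      · right; right; left
        exact ⟨h1, by linarith⟩
      · by_cases hq1 : q ≤ -1
        · right; left
          exact ⟨hlt, hq1⟩
        · right; right; right; right
          exact ⟨h1, by linarith, by linarith⟩
    · have hq1 : 1 ≤ q := by
        rcases h2 with h2 | h2 <;> linarith
      by_cases hp1 : 1 ≤ p
      · left
        exact ⟨hp1, hlt⟩
      · right; right; right; left
        exact ⟨h1, by linarith, hq1⟩
end

section
/- For every real number q > 0 there exist 2×2 positive definite complex matrices A, B such that the inequality exp((log A + log B)/2) ≤ ((A^q + B^q)/2)^{1/q} fails, i.e., ((A^q + B^q)/2)^{1/q} − exp((log A + log B)/2) is not positive semidefinite. -/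
open scoped ComplexOrder

open Matrix in
theorem cfcReal_mulVec_eigen {n : Type*} [Fintype n] [DecidableEq n]
    (f : ℝ → ℝ) (A : Matrix n n ℂ) (hA : A.IsHermitian) (u : n → ℂ) (l : ℝ)
    (hu : A *ᵥ u = (l : ℂ) • u) : Matrix.cfcReal f A *ᵥ u = (f l : ℂ) • u := by
  have key : ∀ g : ℝ → ℝ, Matrix.cfcReal g A = (hA.eigenvectorUnitary : Matrix n n ℂ) *
      Matrix.diagonal (fun i => (g (hA.eigenvalues i) : ℂ)) *
      star (hA.eigenvectorUnitary : Matrix n n ℂ) := by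
    intro g
    simp only [Matrix.cfcReal, dif_pos hA]
  have hAid : A = Matrix.cfcReal id A := by
    rw [key]
    conv_lhs => rw [hA.spectral_theorem]
    simp [Unitary.conjStarAlgAut_apply, Function.comp_def]
  have hU1 : star (hA.eigenvectorUnitary : Matrix n n ℂ) * (hA.eigenvectorUnitary : Matrix n n ℂ) = 1 := by
    simp
  have hU2 : (hA.eigenvectorUnitary : Matrix n n ℂ) * star (hA.eigenvectorUnitary : Matrix n n ℂ) = 1 := by
    simp
  rw [hAid, key] at hu
  rw [key]
  generalize (hA.eigenvectorUnitary : Matrix n n ℂ) = U at *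
  set x := star U *ᵥ u with hx
  have hux : u = U *ᵥ x := by rw [hx, mulVec_mulVec, hU2, one_mulVec]
  have h1 : Matrix.diagonal (fun i => (id (hA.eigenvalues i) : ℂ)) *ᵥ x = (l : ℂ) • x := by
    have := congrArg (fun z => star U *ᵥ z) hu
    simp only [mulVec_smul, ← hx] at this
    rw [mulVec_mulVec, ← mul_assoc, ← mul_assoc, hU1, one_mul, ← mulVec_mulVec, ← hx] at this
    exact this
  have h2 : Matrix.diagonal (fun i => (f (hA.eigenvalues i) : ℂ)) *ᵥ x = (f l : ℂ) • x := by
    ext i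
    have := congrFun h1 i
    simp only [mulVec_diagonal, Pi.smul_apply, smul_eq_mul, id] at this ⊢
    by_cases h : x i = 0
    · simp [h]
    · have := mul_right_cancel₀ h this
      rw [Complex.ofReal_inj.mp this]
  rw [← mulVec_mulVec, ← mulVec_mulVec, ← hx, h2, mulVec_smul, ← hux]

/-- real symmetric 2x2 matrix -/
noncomputable def symM (a b d : ℝ) : Matrix (Fin 2) (Fin 2) ℂ := !![(a : ℂ), b; b, d]

theorem symM_herm (a b d : ℝ) : (symM a b d).IsHermitian := by
  ext i j
  fin_cases i <;> fin_cases j <;> simp [symM]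

open Matrix in
theorem symM_eig (f : ℝ → ℝ) (a b d x y l : ℝ) (h1 : a * x + b * y = l * x)
    (h2 : b * x + d * y = l * y) :
    Matrix.cfcReal f (symM a b d) *ᵥ ![(x : ℂ), y] = ![((f l * x : ℝ) : ℂ), ((f l * y : ℝ) : ℂ)] := by
  rw [cfcReal_mulVec_eigen f _ (symM_herm a b d) _ l]
  · ext i
    fin_cases i <;> simp
  · ext i
    fin_cases i
    · simp [symM, Matrix.mulVec, dotProduct, Fin.sum_univ_two]
      exact_mod_cast h1
    · simp [symM, Matrix.mulVec, dotProduct, Fin.sum_univ_two]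
      exact_mod_cast h2

theorem symM_diag (f : ℝ → ℝ) (a d : ℝ) :
    Matrix.cfcReal f (symM a 0 d) = symM (f a) 0 (f d) := by
  have h1 := symM_eig f a 0 d 1 0 a (by ring) (by ring)
  have h2 := symM_eig f a 0 d 0 1 d (by ring) (by ring)
  ext i j
  have h1 := congrFun h1 i
  have h2 := congrFun h2 i
  simp [Matrix.mulVec, dotProduct, Fin.sum_univ_two] at h1 h2
  fin_cases i <;> fin_cases j <;> simp_all [symM]

theorem symM_pm (f : ℝ → ℝ) (b : ℝ) :
    Matrix.cfcReal f (symM ((b + 1) / 2) ((b - 1) / 2) ((b + 1) / 2)) =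
      symM ((f b + f 1) / 2) ((f b - f 1) / 2) ((f b + f 1) / 2) := by
  have h1 := symM_eig f ((b + 1) / 2) ((b - 1) / 2) ((b + 1) / 2) 1 1 b (by ring) (by ring)
  have h2 := symM_eig f ((b + 1) / 2) ((b - 1) / 2) ((b + 1) / 2) 1 (-1) 1 (by ring) (by ring)
  ext i j
  have h1 := congrFun h1 i
  have h2 := congrFun h2 i
  simp [Matrix.mulVec, dotProduct, Fin.sum_univ_two] at h1 h2
  fin_cases i <;> fin_cases j <;> simp [symM] at h1 h2 ⊢
  · linear_combination (h1 + h2) / 2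
  · linear_combination (h1 - h2) / 2
  · linear_combination (h1 + h2) / 2
  · linear_combination (h1 - h2) / 2

theorem symM_half (a b d a' b' d' : ℝ) :
    (2 : ℂ)⁻¹ • (symM a b d + symM a' b' d') =
      symM ((a + a') / 2) ((b + b') / 2) ((d + d') / 2) := by
  ext i j
  fin_cases i <;> fin_cases j <;> simp [symM] <;> ring

theorem symM_posDef (a b d : ℝ) (ha : 0 < a) (hd : 0 < a * d - b ^ 2) : (symM a b d).PosDef := by
  refine Matrix.PosDef.of_dotProduct_mulVec_pos (symM_herm a b d) ?_
  intro x hx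
  have hR : star x ⬝ᵥ (symM a b d).mulVec x =
      ((a * Complex.normSq (x 0) + d * Complex.normSq (x 1) +
        2 * b * ((x 0).re * (x 1).re + (x 0).im * (x 1).im) : ℝ) : ℂ) := by
    apply Complex.ext <;>
    simp [symM, Matrix.mulVec, dotProduct, Fin.sum_univ_two, Complex.normSq_apply] <;> ring
  rw [hR]
  rw [← Complex.ofReal_zero, Complex.real_lt_real]
  refine pos_of_mul_pos_right (a := a) ?_ ha.le
  have e : a * (a * Complex.normSq (x 0) + d * Complex.normSq (x 1) +
        2 * b * ((x 0).re * (x 1).re + (x 0).im * (x 1).im)) =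
      (a * (x 0).re + b * (x 1).re) ^ 2 + (a * (x 0).im + b * (x 1).im) ^ 2 +
      (a * d - b ^ 2) * Complex.normSq (x 1) := by
    simp only [Complex.normSq_apply]; ring
  by_cases h1 : x 1 = 0
  · have h0 : x 0 ≠ 0 := by
      intro h0
      apply hx
      ext i
      fin_cases i <;> simp [h0, h1]
    have := Complex.normSq_pos.mpr h0
    simp [h1]
    positivity
  · rw [e]
    have := Complex.normSq_pos.mpr h1
    positivity

theorem final_ineq (r L E F : ℝ) (hr1 : 1 ≤ r) (hr3 : r ≤ 3 / 2) (hL : L ≤ 1) (hE : 65 < E)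
    (hF : 0 < F)
    (h : 0 ≤ L * (1 + r ^ 2) - E * (2 - r) ^ 2 / 5 - F * (1 + 2 * r) ^ 2 / 5) : False := by
  have h0 : 0 ≤ F * (1 + 2 * r) ^ 2 := by positivity
  have hr : r ^ 2 ≤ 9 / 4 := by nlinarith
  have h1 : L * (1 + r ^ 2) ≤ 1 * (1 + r ^ 2) :=
    mul_le_mul_of_nonneg_right hL (by positivity)
  have h2 : 1 / 4 ≤ (2 - r) ^ 2 := by nlinarith
  have h3 : E * (1 / 4) ≤ E * (2 - r) ^ 2 := mul_le_mul_of_nonneg_left h2 (by linarith)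
  linarith

set_option maxHeartbeats 1000000 in
open Matrix in
/-- For every real `q > 0` there exist `2 × 2` positive definite complex matrices `A, B`
for which the inequality `exp((log A + log B)/2) ≤ ((A^q + B^q)/2)^(1/q)` fails. -/
theorem exists_logEuclidean_powerMean_counterexample (q : ℝ) (hq : 0 < q) :
    ∃ A B : Matrix (Fin 2) (Fin 2) ℂ, A.PosDef ∧ B.PosDef ∧
      ¬ (Matrix.rpowH ((2 : ℂ)⁻¹ • (Matrix.rpowH A q + Matrix.rpowH B q)) (1 / q) -
          Matrix.expH ((2 : ℂ)⁻¹ • (Matrix.logH A + Matrix.logH B))).PosSemidef := by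
  obtain ⟨t, ht⟩ : ∃ t : ℝ, t = 200 + 5 / q := ⟨_, rfl⟩
  have h5 : 0 < 5 / q := by positivity
  have ht0 : 200 < t := by linarith
  have hqt : 5 ≤ t * q := by
    have : 5 / q * q = 5 := by field_simp
    rw [ht, add_mul, this]; nlinarith
  have hB0 := Real.exp_pos t
  refine ⟨symM 1 0 (Real.exp (-(3 / 4 * t))),
    symM ((Real.exp t + 1) / 2) ((Real.exp t - 1) / 2) ((Real.exp t + 1) / 2), ?_, ?_, ?_⟩
  · apply symM_posDef
    · norm_num
    · have := Real.exp_pos (-(3 / 4 * t))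
      linarith
  · apply symM_posDef
    · positivity
    · nlinarith
  intro hN
  simp only [Matrix.rpowH, Matrix.logH, Matrix.expH, symM_diag, symM_pm, symM_half,
    ← Real.exp_mul, Real.log_exp, Real.log_one, Real.one_rpow] at hN
  obtain ⟨a, ha⟩ : ∃ a : ℝ, a = Real.exp (-(3 / 4 * t) * q) := ⟨_, rfl⟩
  obtain ⟨b, hb⟩ : ∃ b : ℝ, b = Real.exp (t * q) := ⟨_, rfl⟩
  have ha0 : 0 < a := by rw [ha]; exact Real.exp_pos _
  have ha1 : a < 1 := by rw [ha, Real.exp_lt_one_iff]; nlinarith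
  have hb5 : 5 ≤ b := by rw [hb]; linarith [Real.add_one_le_exp (t * q)]
  rw [← ha, ← hb] at hN
  -- the eigenvector `(1, -r)`
  obtain ⟨δ, hδ⟩ : ∃ δ : ℝ, δ = (1 - a) / (b - 1) := ⟨_, rfl⟩
  have hδ0 : 0 < δ := by rw [hδ]; apply div_pos <;> linarith
  have hδ1 : δ ≤ 1 / 4 := by rw [hδ, div_le_iff₀ (by linarith)]; linarith
  have hδe : δ * (b - 1) = 1 - a := by rw [hδ]; field_simp [show b - 1 ≠ 0 by linarith]
  obtain ⟨r, hr⟩ : ∃ r : ℝ, r = δ + Real.sqrt (1 + δ ^ 2) := ⟨_, rfl⟩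
  have hs := Real.sq_sqrt (show 0 ≤ 1 + δ ^ 2 by positivity)
  have hs0 := Real.sqrt_nonneg (1 + δ ^ 2)
  have hr2 : r ^ 2 = 2 * δ * r + 1 := by rw [hr]; nlinarith
  have hr1 : 1 ≤ r := by
    have : 1 ≤ Real.sqrt (1 + δ ^ 2) := Real.one_le_sqrt.mpr (by nlinarith)
    linarith
  have hr3 : r ≤ 3 / 2 := by nlinarith
  obtain ⟨l, hl⟩ : ∃ l : ℝ, 2 * l = 1 + (b + 1) / 2 - r * ((b - 1) / 2) :=
    ⟨(1 + (b + 1) / 2 - r * ((b - 1) / 2)) / 2, by ring⟩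
  have hl2 : 2 * l * r = (a + (b + 1) / 2) * r - (b - 1) / 2 := by
    rw [hl]
    linear_combination (-(b - 1) / 2) * hr2 - r * hδe
  have hl1 : l ≤ 1 := by nlinarith
  have hl0 : 0 ≤ l := by
    by_contra h
    push Not at h
    nlinarith [mul_nonneg (show 0 ≤ (b - 1) / 2 by linarith) (show 0 ≤ r - 1 by linarith)]
  have hM := symM_eig (fun t => t ^ (1 / q)) ((1 + (b + 1) / 2) / 2) ((0 + (b - 1) / 2) / 2)
    ((a + (b + 1) / 2) / 2) 1 (-r) l (by linarith) (by linarith)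
  have hE := symM_eig Real.exp ((0 + (t + 0) / 2) / 2) ((0 + (t - 0) / 2) / 2)
    ((-(3 / 4 * t) + (t + 0) / 2) / 2) 2 1 (3 * t / 8) (by ring) (by ring)
  have hF := symM_eig Real.exp ((0 + (t + 0) / 2) / 2) ((0 + (t - 0) / 2) / 2)
    ((-(3 / 4 * t) + (t + 0) / 2) / 2) 1 (-2) (-t / 4) (by ring) (by ring)
  have hp1 : l ^ (1 / q) ≤ 1 := Real.rpow_le_one hl0 hl1 (by positivity)
  have hE1 : 65 < Real.exp (3 * t / 8) := by linarith [Real.add_one_le_exp (3 * t / 8)]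
  have hF1 := Real.exp_pos (-t / 4)
  have hN := hN.dotProduct_mulVec_nonneg ![((1 : ℝ) : ℂ), ((-r : ℝ) : ℂ)]
  have hu : ![((1 : ℝ) : ℂ), ((-r : ℝ) : ℂ)] =
      (((2 - r) / 5 : ℝ) : ℂ) • ![((2 : ℝ) : ℂ), ((1 : ℝ) : ℂ)] +
      (((1 + 2 * r) / 5 : ℝ) : ℂ) • ![((1 : ℝ) : ℂ), ((-2 : ℝ) : ℂ)] := by
    ext i
    fin_cases i <;> simp <;> ring
  have hG := hu
  apply_fun (fun z => Matrix.cfcReal Real.exp (symM ((0 + (t + 0) / 2) / 2) ((0 + (t - 0) / 2) / 2)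
    ((-(3 / 4 * t) + (t + 0) / 2) / 2)) *ᵥ z) at hG
  rw [mulVec_add, mulVec_smul, mulVec_smul, hE, hF] at hG
  rw [sub_mulVec, hM, hG] at hN
  generalize Real.exp (3 * t / 8) = E at *
  generalize Real.exp (-t / 4) = F at *
  generalize l ^ (1 / q) = L at *
  have hN' : 0 ≤ L * (1 + r ^ 2) - E * (2 - r) ^ 2 / 5 - F * (1 + 2 * r) ^ 2 / 5 := by
    have := (Complex.le_def.mp hN).1
    simp [dotProduct, Fin.sum_univ_two] at this
    nlinarith
  clear hN hu hG hM hE hF hs hs0 hl hl2 hδe hr hδ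
  exact final_ineq r L E F hr1 hr3 hp1 hE1 hF1 hN'
end
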